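/- arXiv:2004.01003 — 2 statements merged into one kernel-verified Lean document; each statement's English description precedes it below -/
import Mathlib

section
/- There exist absolute constants C, c > 0 and an integer N₀ such that for every integer N > N₀ the following holds. Let f(x) = (1/‖x‖)·𝟙_{B(10 N^{-9}, N^{-8})}(x) on ℝ² and θ_k = πk/N for k = 1,…,N. There exists a radial (spherically symmetric) function g ∈ L²(ℝ²) such that: (i) the Fourier transform 𝓕g is supported in the ball B(0, N^{15}); (ii) ‖g − f‖_{L²(ℝ²)} ≤ C·N^{-2}; and (iii) if for each k, h_k ∈ L²(ℝ²) denotes the function with 𝓕h_k = 𝟙_{Γ_{θ_k}}·𝓕g almost everywhere, then ‖ sup_{1≤k≤N} |h_k| ‖_{L²(ℝ²)} ≥ c·(log N)·‖g‖_{L²(ℝ²)}. -/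
open MeasureTheory Real FourierTransform

/-- The Euclidean plane `ℝ²`. -/
noncomputable abbrev Plane := EuclideanSpace ℝ (Fin 2)

/-- The closed half-plane `Γ_θ = {x : x₁ cos θ + x₂ sin θ ≥ 0}`. -/
def halfPlane (θ : ℝ) : Set Plane :=
  {x | 0 ≤ x 0 * Real.cos θ + x 1 * Real.sin θ}

/-- The `L²(ℝ²)` norm. -/
noncomputable def l2norm2 {E : Type*} [NormedAddCommGroup E] (f : Plane → E) : ℝ :=
  (∫ x : Plane, ‖f x‖ ^ 2) ^ ((1:ℝ)/2)

/-- `HasFourierTransform h u` says that the (distributional/L²) Fourier transform of `h` is `u`,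
expressed through the multiplication formula `∫ h ⬝ 𝓕φ = ∫ u ⬝ φ` against Schwartz functions. -/
def HasFourierTransform (h u : Plane → ℂ) : Prop :=
  ∀ φ : SchwartzMap Plane ℂ,
    ∫ x : Plane, h x * 𝓕 (fun y => φ y) x = ∫ ξ : Plane, u ξ * φ ξ

/-- Demeter's function `f(x) = ‖x‖⁻¹ 𝟙_{B(10 N⁻⁹, N⁻⁸)}(x)`. -/
noncomputable def demeterF (N : ℕ) : Plane → ℂ := fun x =>
  if 10 * (N:ℝ) ^ (-9 : ℤ) ≤ ‖x‖ ∧ ‖x‖ < (N:ℝ) ^ (-8 : ℤ) then ((‖x‖⁻¹ : ℝ) : ℂ) else 0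

section
open MeasureTheory Real FourierTransform

lemma fourier_swap {f g : Plane → ℂ} (hf : Integrable f) (hg : Integrable g) :
    ∫ x, 𝓕 f x * g x = ∫ x, f x * 𝓕 g x := by
  have := VectorFourier.integral_fourierIntegral_smul_eq_flip (L := innerₗ Plane)
    (μ := volume) (ν := volume) Real.continuous_fourierChar continuous_inner hf hg
  simp only [smul_eq_mul, flip_innerₗ] at this
  exact this

lemma continuous_fourier {f : Plane → ℂ} (hf : Integrable f) : Continuous (𝓕 f) :=
  VectorFourier.fourierIntegral_continuous Real.continuous_fourierChar
    (L := innerₗ Plane) continuous_inner hf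

lemma norm_fourier_le {f : Plane → ℂ} (x : Plane) : ‖𝓕 f x‖ ≤ ∫ y, ‖f y‖ :=
  VectorFourier.norm_fourierIntegral_le_integral_norm _ _ _ _ _

lemma fourierL2_ae {D : Plane → ℂ} (h1 : Integrable D) (h2 : MemLp D 2) :
    (𝓕 (h2.toLp D) : Lp ℂ 2 (volume : Measure Plane)) =ᵐ[volume] 𝓕 D := by
  apply ae_eq_of_integral_contDiff_smul_eq
  · exact (Lp.memLp _).locallyIntegrable (by norm_num)
  · exact (continuous_fourier h1).locallyIntegrable
  · intro g hg hgc
    have hg₁ : HasCompactSupport (Complex.ofRealCLM ∘ g) := hgc.comp_left rfl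
    have hg₂ : ContDiff ℝ (⊤ : ℕ∞) (Complex.ofRealCLM ∘ g) := by fun_prop
    let φ : SchwartzMap Plane ℂ := hg₁.toSchwartzMap hg₂
    have h := congrArg (fun T => T φ) (Lp.fourier_toTemperedDistribution_eq (h2.toLp D))
    simp only [TemperedDistribution.fourier_apply, Lp.toTemperedDistribution_apply] at h
    have hφ : ∀ x, φ x = (g x : ℂ) := fun x => rfl
    have e1 : ∫ x, g x • (𝓕 (h2.toLp D) : Lp ℂ 2 (volume : Measure Plane)) x
       = ∫ x, φ x • (𝓕 (h2.toLp D) : Lp ℂ 2 (volume : Measure Plane)) x := by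
      simp [hφ]
    rw [e1, ← h]
    have e2 : ∫ x, (𝓕 φ) x • (h2.toLp D : Plane → ℂ) x = ∫ x, 𝓕 (φ : Plane → ℂ) x * D x := by
      apply integral_congr_ae
      filter_upwards [h2.coeFn_toLp] with x hx
      rw [hx, SchwartzMap.fourier_coe]; rfl
    rw [e2, fourier_swap φ.integrable h1]
    simp [hφ]

lemma integral_norm_sq_eq {f : Plane → ℂ} (hf : MemLp f 2) :
    ∫ x, ‖f x‖ ^ 2 = ‖hf.toLp f‖ ^ 2 := by
  have := L2.inner_def (𝕜 := ℂ) (hf.toLp f) (hf.toLp f)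
  have h2 : ‖hf.toLp f‖ ^ 2 = RCLike.re (inner ℂ (hf.toLp f) (hf.toLp f)) := by
    rw [inner_self_eq_norm_sq]
  rw [h2, this, ← integral_re (L2.integrable_inner _ _)]
  apply integral_congr_ae
  filter_upwards [hf.coeFn_toLp] with x hx
  rw [hx, inner_self_eq_norm_sq]

lemma L2mult {D : Plane → ℂ} (h1 : Integrable D) (h2 : MemLp D 2) {S : Set Plane}
    (hS : MeasurableSet S) :
    ∃ E : Plane → ℂ, MemLp E 2 ∧ ∫ x, ‖E x‖ ^ 2 ≤ ∫ x, ‖D x‖ ^ 2 ∧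
      ∀ φ : SchwartzMap Plane ℂ, ∫ x, E x * 𝓕 (fun y => φ y) x =
        ∫ ξ, (Set.indicator S (fun _ => 1) ξ * 𝓕 D ξ) * φ ξ := by
  have hF : MemLp (𝓕 D) 2 := (memLp_congr_ae (fourierL2_ae h1 h2)).1 (Lp.memLp _)
  have hFS : MemLp (S.indicator (𝓕 D)) 2 := hF.indicator hS
  let G : Lp ℂ 2 (volume : Measure Plane) := hFS.toLp _
  let E : Lp ℂ 2 (volume : Measure Plane) := 𝓕⁻ G
  have hEG : 𝓕 E = G := fourier_fourierInv_eq G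
  refine ⟨E, Lp.memLp E, ?_, ?_⟩
  · have a1 : ∫ x, ‖E x‖ ^ 2 = ‖E‖ ^ 2 := by
      rw [integral_norm_sq_eq (Lp.memLp E), Lp.toLp_coeFn]
    have a2 : ‖E‖ = ‖G‖ := by rw [← hEG, Lp.norm_fourier_eq]
    have a3 : ‖G‖ ^ 2 = ∫ x, ‖S.indicator (𝓕 D) x‖ ^ 2 := (integral_norm_sq_eq hFS).symm
    have a4 : ∫ x, ‖𝓕 D x‖ ^ 2 = ∫ x, ‖D x‖ ^ 2 := by
      rw [integral_norm_sq_eq h2, ← Lp.norm_fourier_eq, integral_norm_sq_eq hF]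
      congr 2
      apply Lp.ext
      filter_upwards [hF.coeFn_toLp, fourierL2_ae h1 h2] with x hx hy
      rw [hx, hy]
    rw [a1, a2, a3, ← a4]
    apply integral_mono_of_nonneg
    · exact Filter.Eventually.of_forall fun x => by positivity
    · exact hF.integrable_norm_pow (by norm_num)
    · refine Filter.Eventually.of_forall fun x => ?_
      simp only
      gcongr
      exact norm_indicator_le_norm_self _ _
  · intro φ
    have h := congrArg (fun T => T φ) (Lp.fourier_toTemperedDistribution_eq E)
    simp only [TemperedDistribution.fourier_apply, Lp.toTemperedDistribution_apply] at h
    rw [hEG] at h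
    have e1 : ∫ x, E x * 𝓕 (fun y => φ y) x = ∫ x, (𝓕 φ) x • E x := by
      congr 1; ext x; rw [SchwartzMap.fourier_coe, smul_eq_mul, mul_comm]
    rw [e1, h]
    apply integral_congr_ae
    filter_upwards [hFS.coeFn_toLp] with x hx
    simp only [G]
    rw [hx]
    by_cases h : x ∈ S <;> simp [h, mul_comm]

/-- generalized convolution -/
lemma genConv {Y : Type*} [MeasurableSpace Y] {ν : Measure Y} [SFinite ν] {k : Y → ℂ}
    (hk : Integrable k ν) {τ : Y → Plane} (hτ : Measurable τ) {f : Plane → ℂ}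
    (hfm : Measurable f) (hf : Integrable f) :
    Integrable (fun x => ∫ y, k y * f (x - τ y) ∂ν) ∧
    ∀ ξ, 𝓕 (fun x => ∫ y, k y * f (x - τ y) ∂ν) ξ =
      (∫ y, 𝐞 (-(inner ℝ (τ y) ξ)) • k y ∂ν) * 𝓕 f ξ := by
  have hmeas : AEStronglyMeasurable (fun p : Plane × Y => k p.2 * f (p.1 - τ p.2))
      (volume.prod ν) := by
    refine hk.aestronglyMeasurable.comp_snd.mul ?_
    exact (hfm.comp (measurable_fst.sub (hτ.comp measurable_snd))).aestronglyMeasurable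
  have hInteg : Integrable (fun p : Plane × Y => k p.2 * f (p.1 - τ p.2)) (volume.prod ν) := by
    rw [integrable_prod_iff' hmeas]
    constructor
    · refine Filter.Eventually.of_forall fun y => ?_
      exact (hf.comp_sub_right (τ y)).const_mul (k y)
    · have : (fun y => ∫ x, ‖k y * f (x - τ y)‖) = fun y => ‖k y‖ * ∫ x, ‖f x‖ := by
        ext y
        simp only [norm_mul]
        rw [integral_const_mul, integral_sub_right_eq_self (fun x => ‖f x‖)]
      simp only [this]
      exact hk.norm.mul_const _
  refine ⟨hInteg.integral_prod_left, fun ξ => ?_⟩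
  have hInteg2 : Integrable (fun p : Plane × Y => 𝐞 (-(inner ℝ p.1 ξ)) • (k p.2 * f (p.1 - τ p.2)))
      (volume.prod ν) := by
    have hc : Continuous (fun p : Plane => (𝐞 (-(inner ℝ p ξ)) : ℂ)) := by
      have := Real.continuous_fourierChar
      fun_prop
    refine (hInteg.bdd_mul (c := 1) (f := fun p : Plane × Y => (𝐞 (-(inner ℝ p.1 ξ)) : ℂ))
      (hc.comp_aestronglyMeasurable
        measurable_fst.aestronglyMeasurable) ?_)
    exact Filter.Eventually.of_forall fun p => (Circle.norm_coe _).le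
  rw [Real.fourier_eq]
  have e1 : ∀ x : Plane, 𝐞 (-(inner ℝ x ξ)) • ∫ y, k y * f (x - τ y) ∂ν =
      ∫ y, 𝐞 (-(inner ℝ x ξ)) • (k y * f (x - τ y)) ∂ν := by
    intro x
    simp only [Circle.smul_def, smul_eq_mul]
    rw [← integral_const_mul]
  simp only [e1]
  rw [integral_integral_swap hInteg2, ← integral_mul_const]
  congr 1; ext y
  rw [← integral_sub_right_eq_self _ (-(τ y)), Real.fourier_eq, ← integral_const_mul]
  congr 1; ext x
  simp only [sub_neg_eq_add, add_sub_cancel_right, inner_add_left, neg_add, AddChar.map_add_eq_mul,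
    Circle.smul_def, smul_eq_mul, Circle.coe_mul]
  ring
end

section
open MeasureTheory Real FourierTransform

lemma exists_kernel : ∃ φ : SchwartzMap Plane ℂ, (∀ (A : Plane ≃ₗᵢ[ℝ] Plane) x, φ (A x) = φ x) ∧
    (∀ ξ : Plane, 1 ≤ ‖ξ‖ → 𝓕 (φ : Plane → ℂ) ξ = 0) ∧ ∫ x, φ x = 1 := by
  let c : Plane → ℝ := fun ξ => Real.smoothTransition (2 - 3 * ‖ξ‖ ^ 2)
  have c1 : ContDiff ℝ (⊤ : ℕ∞) c := by
    have : ContDiff ℝ (⊤ : ℕ∞) (fun ξ : Plane => 2 - 3 * ‖ξ‖ ^ 2) :=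
      contDiff_const.sub (contDiff_const.mul (contDiff_norm_sq ℝ))
    exact Real.smoothTransition.contDiff.comp this
  have c0 : ∀ ξ : Plane, 1 ≤ ‖ξ‖ → c ξ = 0 := by
    intro ξ hξ
    apply Real.smoothTransition.zero_of_nonpos
    nlinarith
  have c2 : HasCompactSupport c := by
    apply HasCompactSupport.intro (isCompact_closedBall (0 : Plane) 1)
    intro x hx
    apply c0
    simp at hx
    exact hx.le
  have hg₁ : HasCompactSupport (Complex.ofRealCLM ∘ c) := c2.comp_left rfl
  have hg₂ : ContDiff ℝ (⊤ : ℕ∞) (Complex.ofRealCLM ∘ c) := by fun_prop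
  let χ : SchwartzMap Plane ℂ := hg₁.toSchwartzMap hg₂
  have hχ : ∀ x, χ x = (c x : ℂ) := fun x => rfl
  have hF : 𝓕 ((𝓕⁻ χ : SchwartzMap Plane ℂ) : Plane → ℂ) = χ := by
    rw [← SchwartzMap.fourier_coe, fourier_fourierInv_eq]
  refine ⟨𝓕⁻ χ, ?_, ?_, ?_⟩
  · intro A x
    rw [SchwartzMap.fourierInv_coe, ← Real.fourierInv_comp_linearIsometry]
    have : (χ : Plane → ℂ) ∘ A = χ := by
      ext y
      simp [hχ, c]
    rw [this]
  · intro ξ hξ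
    rw [hF, hχ, c0 ξ hξ]; rfl
  · have : 𝓕 ((𝓕⁻ χ : SchwartzMap Plane ℂ) : Plane → ℂ) 0 = 1 := by
      rw [hF, hχ]
      have : c 0 = 1 := Real.smoothTransition.one_of_one_le (by norm_num)
      simp [this]
    rw [← this, Real.fourier_eq]
    simp

noncomputable def ann (a b : ℝ) : Plane → ℂ := fun x =>
  if a ≤ ‖x‖ ∧ ‖x‖ < b then ((‖x‖⁻¹ : ℝ) : ℂ) else 0

lemma measurable_ann (a b : ℝ) : Measurable (ann a b) := by
  apply Measurable.ite
  · exact (measurableSet_le measurable_const measurable_norm).inter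
      (measurableSet_lt measurable_norm measurable_const)
  · exact Complex.measurable_ofReal.comp measurable_norm.inv
  · exact measurable_const

lemma norm_ann_le {a b : ℝ} (ha : 0 < a) (x : Plane) : ‖ann a b x‖ ≤ a⁻¹ := by
  unfold ann
  split_ifs with h
  · simp only [Complex.ofReal_inv, norm_inv, Complex.norm_real, norm_norm]
    exact inv_anti₀ ha h.1
  · simp; exact ha.le

lemma ann_eq_zero {a b : ℝ} {x : Plane} (h : b ≤ ‖x‖) : ann a b x = 0 := by
  unfold ann
  rw [if_neg]; intro h'; linarith [h'.2]

lemma ann_memLp {a b : ℝ} (ha : 0 < a) (p : ENNReal) : MemLp (ann a b) p := by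
  have h1 : ann a b = (Metric.ball (0:Plane) b).indicator (ann a b) := by
    ext x
    by_cases h : x ∈ Metric.ball (0:Plane) b
    · simp [h]
    · rw [Set.indicator_of_notMem h, ann_eq_zero]; simpa using h
  rw [h1, memLp_indicator_iff_restrict Metric.isOpen_ball.measurableSet]
  have : IsFiniteMeasure ((volume : Measure Plane).restrict (Metric.ball 0 b)) :=
    ⟨by rw [Measure.restrict_apply_univ]; exact measure_ball_lt_top⟩
  exact MemLp.of_bound (measurable_ann a b).aestronglyMeasurable a⁻¹
    (Filter.Eventually.of_forall (norm_ann_le ha))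

lemma ann_integrable {a b : ℝ} (ha : 0 < a) : Integrable (ann a b) :=
  memLp_one_iff_integrable.1 (ann_memLp ha 1)

noncomputable def kap : ℝ := (volume : Measure Plane).real (Metric.ball 0 1)

lemma kap_pos : 0 < kap := by
  unfold kap
  exact ENNReal.toReal_pos (Metric.measure_ball_pos volume 0 one_pos).ne' measure_ball_lt_top.ne

lemma vol_ball {r : ℝ} (hr : 0 ≤ r) :
    (volume : Measure Plane) (Metric.ball 0 r) = ENNReal.ofReal (r ^ 2 * kap) := by
  rw [Measure.addHaar_ball _ _ hr, ENNReal.ofReal_mul (by positivity), kap, Measure.real,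
    ENNReal.ofReal_toReal measure_ball_lt_top.ne]
  simp

lemma vol_cball {r : ℝ} (hr : 0 ≤ r) :
    (volume : Measure Plane) (Metric.closedBall 0 r) = ENNReal.ofReal (r ^ 2 * kap) := by
  rw [Measure.addHaar_closedBall _ _ hr, ENNReal.ofReal_mul (by positivity), kap, Measure.real,
    ENNReal.ofReal_toReal measure_ball_lt_top.ne]
  simp

lemma vol_layer {r s : ℝ} (hr : 0 < r) (hs : 0 ≤ s) :
    (volume : Measure Plane) {x | |‖x‖ - r| ≤ s} ≤ ENNReal.ofReal (4 * (r * s + s ^ 2) * kap) := by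
  have hk := kap_pos
  have h1 : {x : Plane | |‖x‖ - r| ≤ s} ⊆ Metric.closedBall 0 (r + s) \ Metric.ball 0 (r - s) := by
    intro x hx
    have := abs_le.1 hx.out
    simp
    constructor <;> linarith
  refine (measure_mono h1).trans ?_
  rcases le_or_gt s r with h | h
  · rw [measure_sdiff (fun x hx => by simp at hx ⊢; linarith) measurableSet_ball.nullMeasurableSet
      measure_ball_lt_top.ne, vol_ball (by linarith), vol_cball (by linarith),
      ← ENNReal.ofReal_sub _ (by positivity)]
    apply ENNReal.ofReal_le_ofReal
    nlinarith [sq_nonneg s]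
  · refine (measure_mono Set.sdiff_subset).trans ?_
    rw [vol_cball (by linarith)]
    apply ENNReal.ofReal_le_ofReal
    gcongr
    nlinarith

lemma ann_diff {a b : ℝ} (ha : 0 < a) (x y : Plane) :
    ‖ann a b (x - y) - ann a b x‖ ^ 2 ≤
      Set.indicator {x : Plane | |‖x‖ - a| ≤ ‖y‖} (fun _ => a⁻¹ ^ 2) x +
      Set.indicator {x : Plane | |‖x‖ - b| ≤ ‖y‖} (fun _ => a⁻¹ ^ 2) x +
      Set.indicator (Metric.ball (0:Plane) b) (fun _ => (‖y‖ * a⁻¹ ^ 2) ^ 2) x := by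
  have t1 : ‖x‖ - ‖y‖ ≤ ‖x - y‖ := norm_sub_norm_le x y
  have t2 : ‖x - y‖ ≤ ‖x‖ + ‖y‖ := norm_sub_le x y
  have p1 : 0 ≤ Set.indicator {x : Plane | |‖x‖ - a| ≤ ‖y‖} (fun _ => a⁻¹ ^ 2) x :=
    Set.indicator_nonneg (fun _ _ => by positivity) _
  have p2 : 0 ≤ Set.indicator {x : Plane | |‖x‖ - b| ≤ ‖y‖} (fun _ => a⁻¹ ^ 2) x :=
    Set.indicator_nonneg (fun _ _ => by positivity) _
  have p3 : 0 ≤ Set.indicator (Metric.ball (0:Plane) b) (fun _ => (‖y‖ * a⁻¹ ^ 2) ^ 2) x :=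
    Set.indicator_nonneg (fun _ _ => by positivity) _
  have q1 : |‖x‖ - a| ≤ ‖y‖ →
      Set.indicator {x : Plane | |‖x‖ - a| ≤ ‖y‖} (fun _ => a⁻¹ ^ 2) x = a⁻¹ ^ 2 := fun h =>
    Set.indicator_of_mem (s := {x : Plane | |‖x‖ - a| ≤ ‖y‖}) h _
  have q2 : |‖x‖ - b| ≤ ‖y‖ →
      Set.indicator {x : Plane | |‖x‖ - b| ≤ ‖y‖} (fun _ => a⁻¹ ^ 2) x = a⁻¹ ^ 2 := fun h =>
    Set.indicator_of_mem (s := {x : Plane | |‖x‖ - b| ≤ ‖y‖}) h _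
  by_cases hx : a ≤ ‖x‖ ∧ ‖x‖ < b
  · by_cases hxy : a ≤ ‖x - y‖ ∧ ‖x - y‖ < b
    · rw [Set.indicator_of_mem (s := Metric.ball (0:Plane) b) (by simpa using hx.2)]
      suffices ‖ann a b (x - y) - ann a b x‖ ≤ ‖y‖ * a⁻¹ ^ 2 by
        have : ‖ann a b (x - y) - ann a b x‖ ^ 2 ≤ (‖y‖ * a⁻¹ ^ 2) ^ 2 := by gcongr
        linarith
      unfold ann
      rw [if_pos hx, if_pos hxy, ← Complex.ofReal_sub, Complex.norm_real, Real.norm_eq_abs]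
      have h0 : 0 < ‖x‖ := by linarith
      have h0' : 0 < ‖x - y‖ := by linarith
      rw [inv_sub_inv h0'.ne' h0.ne', abs_div, abs_of_pos (mul_pos h0' h0), div_eq_mul_inv, mul_inv,
        pow_two]
      have : |‖x‖ - ‖x - y‖| ≤ ‖y‖ := by rw [abs_le]; constructor <;> linarith
      gcongr
      · exact hxy.1
      · exact hx.1
    · have h0 : ann a b (x - y) = 0 := if_neg hxy
      rw [h0, zero_sub, norm_neg]
      have : ‖ann a b x‖ ^ 2 ≤ a⁻¹ ^ 2 := by gcongr; exact norm_ann_le ha x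
      rw [not_and_or, not_le, not_lt] at hxy
      rcases hxy with h | h
      · rw [q1 (by rw [abs_le]; constructor <;> linarith)]; linarith
      · rw [q2 (by rw [abs_le]; constructor <;> linarith)]; linarith
  · have h0 : ann a b x = 0 := if_neg hx
    rw [h0, sub_zero]
    by_cases hxy : a ≤ ‖x - y‖ ∧ ‖x - y‖ < b
    · have : ‖ann a b (x - y)‖ ^ 2 ≤ a⁻¹ ^ 2 := by gcongr; exact norm_ann_le ha _
      rw [not_and_or, not_le, not_lt] at hx
      rcases hx with h | h
      · rw [q1 (by rw [abs_le]; constructor <;> linarith)]; linarith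
      · rw [q2 (by rw [abs_le]; constructor <;> linarith)]; linarith
    · have h0 : ann a b (x - y) = 0 := if_neg hxy
      rw [h0, norm_zero]; linarith

lemma omega_bound {a b : ℝ} (ha : 0 < a) (hab : a < b) (y : Plane) :
    ∫⁻ x, ENNReal.ofReal (‖ann a b (x - y) - ann a b x‖ ^ 2) ≤
      ENNReal.ofReal (kap * (8 * a⁻¹ ^ 2 * b * ‖y‖ + 9 * a⁻¹ ^ 4 * b ^ 2 * ‖y‖ ^ 2)) := by
  have hk := kap_pos
  have hb : 0 < b := ha.trans hab
  have hm : ∀ r : ℝ, MeasurableSet {x : Plane | |‖x‖ - r| ≤ ‖y‖} := fun r =>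
    measurableSet_le (by fun_prop) measurable_const
  calc _ ≤ ∫⁻ x, (Set.indicator {x : Plane | |‖x‖ - a| ≤ ‖y‖} (fun _ => ENNReal.ofReal (a⁻¹ ^ 2)) x +
      Set.indicator {x : Plane | |‖x‖ - b| ≤ ‖y‖} (fun _ => ENNReal.ofReal (a⁻¹ ^ 2)) x +
      Set.indicator (Metric.ball (0:Plane) b) (fun _ => ENNReal.ofReal ((‖y‖ * a⁻¹ ^ 2) ^ 2)) x) := by
        apply lintegral_mono
        intro x
        refine (ENNReal.ofReal_le_ofReal (ann_diff ha x y)).trans ?_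
        refine ENNReal.ofReal_add_le.trans ?_
        refine add_le_add (ENNReal.ofReal_add_le.trans (add_le_add ?_ ?_)) ?_
        all_goals
          apply le_of_eq
          simp only [Set.indicator]
          split_ifs <;> simp
    _ = ENNReal.ofReal (a⁻¹ ^ 2) * volume {x : Plane | |‖x‖ - a| ≤ ‖y‖} +
        ENNReal.ofReal (a⁻¹ ^ 2) * volume {x : Plane | |‖x‖ - b| ≤ ‖y‖} +
        ENNReal.ofReal ((‖y‖ * a⁻¹ ^ 2) ^ 2) * volume (Metric.ball (0:Plane) b) := by
        rw [lintegral_add_left, lintegral_add_left, lintegral_indicator_const (hm a),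
          lintegral_indicator_const (hm b), lintegral_indicator_const measurableSet_ball]
        · exact measurable_const.indicator (hm a)
        · exact (measurable_const.indicator (hm a)).add (measurable_const.indicator (hm b))
    _ ≤ ENNReal.ofReal (a⁻¹ ^ 2) * ENNReal.ofReal (4 * (a * ‖y‖ + ‖y‖ ^ 2) * kap) +
        ENNReal.ofReal (a⁻¹ ^ 2) * ENNReal.ofReal (4 * (b * ‖y‖ + ‖y‖ ^ 2) * kap) +
        ENNReal.ofReal ((‖y‖ * a⁻¹ ^ 2) ^ 2) * ENNReal.ofReal (b ^ 2 * kap) := by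
        rw [vol_ball hb.le]
        gcongr
        · exact vol_layer ha (norm_nonneg _)
        · exact vol_layer hb (norm_nonneg _)
    _ ≤ _ := by
        rw [← ENNReal.ofReal_mul (by positivity), ← ENNReal.ofReal_mul (by positivity),
          ← ENNReal.ofReal_mul (by positivity), ← ENNReal.ofReal_add (by positivity) (by positivity),
          ← ENNReal.ofReal_add (by positivity) (by positivity)]
        apply ENNReal.ofReal_le_ofReal
        have h1 : 1 ≤ a⁻¹ ^ 2 * b ^ 2 := by
          rw [← mul_pow]; apply one_le_pow₀
          rw [inv_mul_eq_div, one_le_div ha]; exact hab.le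
        have h2 : a⁻¹ ^ 2 * ‖y‖ ^ 2 ≤ a⁻¹ ^ 4 * b ^ 2 * ‖y‖ ^ 2 := by
          calc a⁻¹ ^ 2 * ‖y‖ ^ 2 = a⁻¹ ^ 2 * ‖y‖ ^ 2 * 1 := by ring
            _ ≤ a⁻¹ ^ 2 * ‖y‖ ^ 2 * (a⁻¹ ^ 2 * b ^ 2) := by gcongr
            _ = _ := by ring
        have h3 : a⁻¹ ^ 2 * (a * ‖y‖) ≤ a⁻¹ ^ 2 * (b * ‖y‖) := by gcongr
        have : 0 ≤ kap * (4 * (a⁻¹ ^ 2 * (b * ‖y‖) - a⁻¹ ^ 2 * (a * ‖y‖)) +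
          8 * (a⁻¹ ^ 4 * b ^ 2 * ‖y‖ ^ 2 - a⁻¹ ^ 2 * ‖y‖ ^ 2)) := by
          apply mul_nonneg hk.le; linarith
        linarith
end

section
open MeasureTheory Real FourierTransform

lemma cs_lintegral {Y : Type*} [MeasurableSpace Y] {ν : Measure Y} {u v : Y → ENNReal}
    (hu : AEMeasurable u ν) (hv : AEMeasurable v ν) :
    (∫⁻ y, u y * v y ∂ν) ^ 2 ≤ (∫⁻ y, u y ∂ν) * ∫⁻ y, u y * v y ^ 2 ∂ν := by
  have h := ENNReal.lintegral_mul_le_Lp_mul_Lq ν (p := 2) (q := 2)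
    (by norm_num [Real.holderConjugate_iff]) (f := fun y => u y ^ (1/2:ℝ))
    (g := fun y => u y ^ (1/2:ℝ) * v y) (hu.pow_const _) ((hu.pow_const _).mul hv)
  have e0 : ∀ z : ENNReal, z ^ (1/2:ℝ) * z ^ (1/2:ℝ) = z := by
    intro z
    rw [← ENNReal.rpow_add_of_nonneg _ _ (by norm_num) (by norm_num)]; norm_num
  have e1 : ∀ z : ENNReal, (z ^ (1/2:ℝ)) ^ (2:ℝ) = z := by
    intro z
    rw [← ENNReal.rpow_mul]; norm_num
  have e2 : ∀ z : ENNReal, (z ^ (1/2:ℝ)) ^ 2 = z := by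
    intro z
    rw [pow_two, e0]
  simp only [Pi.mul_apply, ← mul_assoc, e0, e1, ENNReal.mul_rpow_of_nonneg _ _ (zero_le_two (α := ℝ)),
    ENNReal.rpow_two] at h
  calc _ ≤ _ := pow_le_pow_left' h 2
    _ = _ := by rw [mul_pow, e2, e2]

lemma exists_g : ∃ C : ℝ, 0 < C ∧ ∀ N : ℕ, 10 < N → ∃ g : Plane → ℂ,
    Integrable g (volume : Measure Plane) ∧ MemLp g 2 (volume : Measure Plane) ∧
    (∀ x y : Plane, ‖x‖ = ‖y‖ → g x = g y) ∧
    (∀ ξ : Plane, (N:ℝ) ^ 15 ≤ ‖ξ‖ → 𝓕 g ξ = 0) ∧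
    ∫ x, ‖g x - demeterF N x‖ ^ 2 ≤ (C * (N:ℝ) ^ (-2 : ℤ)) ^ 2 := by
  obtain ⟨φ, hφA, hφF, hφ1⟩ := exists_kernel
  let A1 : ℝ := ∫ y, ‖φ y‖
  let A2 : ℝ := ∫ y, ‖φ y‖ * (‖y‖ + ‖y‖ ^ 2)
  have iA2 : Integrable (fun y => ‖φ y‖ * (‖y‖ + ‖y‖ ^ 2)) := by
    have i1 := SchwartzMap.integrable_pow_mul volume φ 1
    have i2 := SchwartzMap.integrable_pow_mul volume φ 2
    refine (i1.add i2).congr (Filter.Eventually.of_forall fun y => ?_)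
    simp; ring
  have hk := kap_pos
  have hA1 : 0 ≤ A1 := integral_nonneg fun _ => norm_nonneg _
  have hA2 : 0 ≤ A2 := integral_nonneg fun _ => by positivity
  refine ⟨√(A1 * (9 * kap * A2)) + 1, by positivity, fun N hN => ?_⟩
  have hN' : (10:ℝ) < N := by exact_mod_cast hN
  have hN0 : (0:ℝ) < N := by linarith
  set a : ℝ := 10 * (N:ℝ) ^ (-9 : ℤ) with ha_def
  set b : ℝ := (N:ℝ) ^ (-8 : ℤ) with hb_def
  have ha : 0 < a := by positivity
  have hab : a < b := by
    have : b = N * (N:ℝ) ^ (-9 : ℤ) := by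
      rw [hb_def, show (-8:ℤ) = 1 + (-9) by norm_num, zpow_add₀ hN0.ne', zpow_one]
    rw [this, ha_def]
    gcongr
  have hfd : demeterF N = ann a b := rfl
  rw [hfd]
  let f := ann a b
  let τ : Plane → Plane := fun y => ((N:ℝ) ^ 15)⁻¹ • y
  have hτ : Measurable τ := measurable_const_smul _
  obtain ⟨hgi, hgF⟩ := genConv (φ.integrable (μ := volume)) hτ (measurable_ann a b) (ann_integrable ha (b := b))
  set g : Plane → ℂ := fun x => ∫ y, φ y * ann a b (x - τ y) with hg
  have key : ∫⁻ x, ‖g x - ann a b x‖ₑ ^ 2 ≤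
      ENNReal.ofReal (A1 * (9 * kap * (N:ℝ) ^ (-4:ℤ) * A2)) := by
    have hpt : ∀ x, ‖g x - ann a b x‖ₑ ^ 2 ≤ (∫⁻ y, ‖φ y‖ₑ) *
        ∫⁻ y, ‖φ y‖ₑ * ‖ann a b (x - τ y) - ann a b x‖ₑ ^ 2 := by
      intro x
      have : g x - ann a b x = ∫ y, φ y * (ann a b (x - τ y) - ann a b x) := by
        simp only [mul_sub]
        rw [integral_sub, integral_mul_const, hφ1, one_mul]
        · refine φ.integrable.mul_bdd (c := a⁻¹) ?_ ?_
          · exact ((measurable_ann a b).comp (measurable_const.sub hτ)).aestronglyMeasurable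
          · exact Filter.Eventually.of_forall fun y => norm_ann_le ha _
        · exact φ.integrable.mul_const _
      rw [this]
      calc _ ≤ (∫⁻ y, ‖φ y‖ₑ * ‖ann a b (x - τ y) - ann a b x‖ₑ) ^ 2 := by
            gcongr
            refine (enorm_integral_le_lintegral_enorm _).trans ?_
            simp only [enorm_mul]; exact le_rfl
        _ ≤ _ := by
            apply cs_lintegral
            · exact φ.integrable.aestronglyMeasurable.enorm
            · exact (((measurable_ann a b).comp (measurable_const.sub hτ)).sub
                measurable_const).enorm.aemeasurable
    have hw : ∀ y, ∫⁻ x, ‖ann a b (x - τ y) - ann a b x‖ₑ ^ 2 ≤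
        ENNReal.ofReal (9 * kap * (N:ℝ) ^ (-4:ℤ) * (‖y‖ + ‖y‖ ^ 2)) := by
      intro y
      have h := omega_bound ha hab (τ y)
      have e : ∀ x, ENNReal.ofReal (‖ann a b (x - τ y) - ann a b x‖ ^ 2) =
          ‖ann a b (x - τ y) - ann a b x‖ₑ ^ 2 := fun x => by
        rw [ENNReal.ofReal_pow (norm_nonneg _), ofReal_norm]
      simp only [e] at h
      refine h.trans (ENNReal.ofReal_le_ofReal ?_)
      have hτn : ‖τ y‖ = ((N:ℝ) ^ 15)⁻¹ * ‖y‖ := by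
        simp [τ, norm_smul]
      have hai : a⁻¹ ≤ (N:ℝ) ^ 9 := by
        have : (0:ℝ) < (N:ℝ) ^ 9 := by positivity
        have h9 : (N:ℝ) ^ (-9:ℤ) = ((N:ℝ) ^ 9)⁻¹ := by rw [zpow_neg]; norm_cast
        rw [ha_def, h9, mul_inv, inv_inv]
        linarith
      have hbb : b = ((N:ℝ) ^ 8)⁻¹ := by rw [hb_def, zpow_neg]; norm_cast
      have h4 : (N:ℝ) ^ (-4:ℤ) = ((N:ℝ) ^ 4)⁻¹ := by rw [zpow_neg]; norm_cast
      have hai0 : 0 < a⁻¹ := by positivity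
      have f1 : a⁻¹ ^ 2 * b * ‖τ y‖ ≤ ((N:ℝ) ^ 4)⁻¹ * ‖y‖ := by
        calc _ ≤ ((N:ℝ) ^ 9) ^ 2 * b * ‖τ y‖ := by gcongr
          _ = ((N:ℝ) ^ 5)⁻¹ * ‖y‖ := by rw [hbb, hτn]; field_simp
          _ ≤ _ := by gcongr <;> first | linarith | norm_num
      have f2 : a⁻¹ ^ 4 * b ^ 2 * ‖τ y‖ ^ 2 ≤ ((N:ℝ) ^ 4)⁻¹ * ‖y‖ ^ 2 := by
        calc _ ≤ ((N:ℝ) ^ 9) ^ 4 * b ^ 2 * ‖τ y‖ ^ 2 := by gcongr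
          _ = ((N:ℝ) ^ 10)⁻¹ * ‖y‖ ^ 2 := by rw [hbb, hτn]; field_simp
          _ ≤ _ := by gcongr <;> first | linarith | norm_num
      rw [h4]
      calc _ = kap * (8 * (a⁻¹ ^ 2 * b * ‖τ y‖) + 9 * (a⁻¹ ^ 4 * b ^ 2 * ‖τ y‖ ^ 2)) := by ring
        _ ≤ kap * (9 * (((N:ℝ) ^ 4)⁻¹ * ‖y‖) + 9 * (((N:ℝ) ^ 4)⁻¹ * ‖y‖ ^ 2)) := by
          gcongr; norm_num
        _ = _ := by ring
    have hl1 : ∫⁻ y, ‖φ y‖ₑ = ENNReal.ofReal A1 := by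
      rw [← ofReal_integral_norm_eq_lintegral_enorm φ.integrable]
    calc _ ≤ ∫⁻ x, (∫⁻ y, ‖φ y‖ₑ) *
        ∫⁻ y, ‖φ y‖ₑ * ‖ann a b (x - τ y) - ann a b x‖ₑ ^ 2 := lintegral_mono hpt
      _ = (∫⁻ y, ‖φ y‖ₑ) * ∫⁻ x, ∫⁻ y, ‖φ y‖ₑ * ‖ann a b (x - τ y) - ann a b x‖ₑ ^ 2 := by
        rw [lintegral_const_mul']
        rw [hl1]; exact ENNReal.ofReal_ne_top
      _ = (∫⁻ y, ‖φ y‖ₑ) * ∫⁻ y, ∫⁻ x, ‖φ y‖ₑ * ‖ann a b (x - τ y) - ann a b x‖ₑ ^ 2 := by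
        rw [lintegral_lintegral_swap]
        apply Measurable.aemeasurable
        have m1 : Measurable (fun p : Plane × Plane => ‖φ p.2‖ₑ) :=
          (φ.continuous.measurable.comp measurable_snd).enorm
        refine m1.mul (Measurable.pow_const (Measurable.enorm ?_) _)
        exact ((measurable_ann a b).comp (measurable_fst.sub (hτ.comp measurable_snd))).sub
          ((measurable_ann a b).comp measurable_fst)
      _ ≤ ENNReal.ofReal A1 * ∫⁻ y, ENNReal.ofReal (9 * kap * (N:ℝ) ^ (-4:ℤ) *
            (‖φ y‖ * (‖y‖ + ‖y‖ ^ 2))) := by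
        rw [hl1]
        gcongr with y
        rw [lintegral_const_mul' _ _ enorm_ne_top]
        refine (mul_le_mul_right (hw y) _).trans ?_
        rw [← ofReal_norm, ← ENNReal.ofReal_mul (norm_nonneg _)]
        apply ENNReal.ofReal_le_ofReal
        apply le_of_eq; ring
      _ = _ := by
        rw [← ofReal_integral_eq_lintegral_ofReal (iA2.const_mul _), integral_const_mul,
          ← ENNReal.ofReal_mul hA1]
        exact Filter.Eventually.of_forall fun y => by
          have := hk.le
          simp only [Pi.zero_apply]; positivity
  have hDm : MemLp (fun x => g x - ann a b x) 2 := by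
    have hm : AEStronglyMeasurable (fun x => g x - ann a b x) volume :=
      hgi.aestronglyMeasurable.sub (measurable_ann a b).aestronglyMeasurable
    refine ⟨hm, ?_⟩
    rw [eLpNorm_lt_top_iff_lintegral_rpow_enorm_lt_top (by norm_num) (by norm_num)]
    simp only [ENNReal.toReal_ofNat, ENNReal.rpow_two]
    exact key.trans_lt ENNReal.ofReal_lt_top
  refine ⟨g, hgi, ?_, ?_, ?_, ?_⟩
  · have := hDm.add (ann_memLp ha 2 (b := b))
    convert this using 1
    ext x; simp
  · intro x y hxy
    let A : Plane ≃ₗᵢ[ℝ] Plane := (ℝ ∙ (x - y))ᗮ.reflection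
    have hA : A x = y := Submodule.reflection_sub hxy
    rw [← hA]
    simp only [hg]
    rw [← A.measurePreserving.integral_comp' (f := A.toMeasurableEquiv)
      (fun z => φ z * ann a b (A x - τ z))]
    congr 1; ext z
    have e1 : A x - τ (A z) = A (x - τ z) := by
      simp [τ, map_sub, map_smul]
    change _ = φ (A z) * ann a b (A x - τ (A z))
    rw [hφA, e1]
    simp only [ann, LinearIsometryEquiv.norm_map]
  · intro ξ hξ
    rw [hgF ξ]
    have : ∫ y, 𝐞 (-(inner ℝ (τ y) ξ)) • φ y = 𝓕 (φ : Plane → ℂ) (((N:ℝ) ^ 15)⁻¹ • ξ) := by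
      rw [Real.fourier_eq]
      simp only [τ, inner_smul_left, inner_smul_right]
      rfl
    rw [this, hφF, zero_mul]
    rw [norm_smul, norm_inv, norm_pow, Real.norm_natCast, inv_mul_eq_div, one_le_div (by positivity)]
    exact hξ
  · have h4 : (N:ℝ) ^ (-4:ℤ) = ((N:ℝ) ^ (-2 : ℤ)) ^ 2 := by
      rw [← zpow_natCast, ← zpow_mul]; norm_num
    have e : ∀ x, ENNReal.ofReal (‖g x - ann a b x‖ ^ 2) =
        ‖g x - ann a b x‖ₑ ^ 2 := fun x => by
      rw [ENNReal.ofReal_pow (norm_nonneg _), ofReal_norm]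
    rw [integral_eq_lintegral_of_nonneg_ae (f := fun x => ‖g x - ann a b x‖ ^ 2)
      (Filter.Eventually.of_forall fun x => by simp only [Pi.zero_apply]; positivity)
      (hDm.1.norm.pow 2)]
    simp only [e]
    refine (ENNReal.toReal_mono ENNReal.ofReal_ne_top key).trans ?_
    rw [ENNReal.toReal_ofReal (by positivity), h4, mul_pow]
    have : A1 * (9 * kap * A2) ≤ (√(A1 * (9 * kap * A2)) + 1) ^ 2 := by
      have h0 : 0 ≤ A1 * (9 * kap * A2) := by positivity
      nlinarith [Real.sq_sqrt h0, Real.sqrt_nonneg (A1 * (9 * kap * A2))]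
    calc _ = A1 * (9 * kap * A2) * ((N:ℝ) ^ (-2 : ℤ)) ^ 2 := by ring
      _ ≤ _ := by gcongr
end

section
open MeasureTheory Real FourierTransform Filter Topology

noncomputable def vv (θ : ℝ) : Plane := !₂[Real.cos θ, Real.sin θ]

lemma inner_vv (θ : ℝ) (x : Plane) : inner ℝ (vv θ) x = x 0 * Real.cos θ + x 1 * Real.sin θ := by
  simp [vv, PiLp.inner_apply, Fin.sum_univ_two]

lemma norm_vv (θ : ℝ) : ‖vv θ‖ = 1 := by
  simp [vv, EuclideanSpace.norm_eq, Fin.sum_univ_two]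

noncomputable def mdel (δ s : ℝ) : ℝ := Real.exp (-(δ * max s 0)) - Real.exp (-(δ⁻¹ * max s 0))

noncomputable def Kdel (δ t : ℝ) : ℂ :=
  ((δ : ℂ) - 2 * π * Complex.I * t)⁻¹ - (((δ⁻¹ : ℝ) : ℂ) - 2 * π * Complex.I * t)⁻¹

lemma mdel_cont (δ : ℝ) : Continuous (mdel δ) := by unfold mdel; fun_prop

lemma mdel_of_nonpos {δ s : ℝ} (hs : s ≤ 0) : mdel δ s = 0 := by simp [mdel, max_eq_right hs]

lemma mdel_abs {δ s : ℝ} (hδ : 0 < δ) : |mdel δ s| ≤ 1 := by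
  have h1 : Real.exp (-(δ * max s 0)) ≤ 1 := by
    rw [Real.exp_le_one_iff]
    have : 0 ≤ δ * max s 0 := mul_nonneg hδ.le (le_max_right _ _)
    linarith
  have h2 : Real.exp (-(δ⁻¹ * max s 0)) ≤ 1 := by
    rw [Real.exp_le_one_iff]
    have : 0 ≤ δ⁻¹ * max s 0 := mul_nonneg (inv_pos.2 hδ).le (le_max_right _ _)
    linarith
  have := Real.exp_pos (-(δ * max s 0))
  have := Real.exp_pos (-(δ⁻¹ * max s 0))
  unfold mdel
  rw [abs_le]; constructor <;> linarith

lemma mdel_ind (δ : ℝ) : (fun s => (mdel δ s : ℂ)) = Set.indicator (Set.Ioi 0)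
    (fun s : ℝ => Complex.exp ((-δ : ℂ) * s) - Complex.exp ((-(δ⁻¹:ℝ) : ℂ) * s)) := by
  ext s
  by_cases h : 0 < s
  · rw [Set.indicator_of_mem (by exact h)]
    simp [mdel, max_eq_left h.le]
  · rw [Set.indicator_of_notMem (by exact h), mdel_of_nonpos (not_lt.1 h)]; simp

lemma int_exp {c : ℝ} (hc : 0 < c) (t : ℝ) : IntegrableOn (fun s : ℝ => Complex.exp ((-(c - 2 * π * Complex.I * t) : ℂ) * s)) (Set.Ioi 0)
  ∧ ∫ s in Set.Ioi (0:ℝ), Complex.exp ((-(c - 2 * π * Complex.I * t) : ℂ) * s) = (c - 2 * π * Complex.I * t : ℂ)⁻¹ := by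
  have hre : (-(c - 2 * π * Complex.I * t) : ℂ).re < 0 := by simp [hc]
  refine ⟨integrableOn_exp_mul_complex_Ioi hre 0, ?_⟩
  rw [integral_exp_mul_complex_Ioi hre 0]
  rw [Complex.ofReal_zero, mul_zero, Complex.exp_zero, neg_div_neg_eq, one_div]

lemma mdel_int {δ : ℝ} (hδ : 0 < δ) : Integrable (fun s => (mdel δ s : ℂ)) := by
  rw [mdel_ind, integrable_indicator_iff measurableSet_Ioi]
  have h1 := (int_exp hδ 0).1
  have h2 := (int_exp (inv_pos.2 hδ) 0).1
  refine IntegrableOn.congr_fun (h1.sub h2) (fun s _ => ?_) measurableSet_Ioi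
  simp

lemma mdel_fourierInv {δ : ℝ} (hδ : 0 < δ) :
    𝓕⁻ (fun s => (mdel δ s : ℂ)) = Kdel δ := by
  ext t
  rw [Real.fourierInv_eq']
  have h1 := (int_exp hδ t)
  have h2 := (int_exp (inv_pos.2 hδ) t)
  unfold Kdel
  rw [← h1.2, ← h2.2, ← integral_sub h1.1 h2.1, ← integral_indicator measurableSet_Ioi]
  congr 1
  ext s
  have := congrFun (mdel_ind δ) s
  rw [this, smul_eq_mul]
  by_cases h : 0 < s
  · rw [Set.indicator_of_mem (by exact h), Set.indicator_of_mem (by exact h), mul_sub,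
      ← Complex.exp_add, ← Complex.exp_add]
    congr 2
    · simp; ring
    · simp; ring
  · rw [Set.indicator_of_notMem (by exact h), Set.indicator_of_notMem (by exact h), mul_zero]

lemma norm_den_ge (c t : ℝ) : |t| ≤ ‖(c - 2 * π * Complex.I * t : ℂ)‖ := by
  have := Complex.abs_im_le_norm (c - 2 * π * Complex.I * t : ℂ)
  simp at this
  have h3 := Real.pi_gt_three
  have h4 : |t| ≤ |2 * π * t| := by
    rw [abs_mul, abs_of_pos (by positivity : 0 < 2 * π)]
    nlinarith [abs_nonneg t]
  have h5 : |2 * π * t| = 2 * |π| * |t| := by rw [abs_mul, abs_mul]; simp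
  linarith

lemma norm_den_ge' {c : ℝ} (_hc : 0 < c) (t : ℝ) : c ≤ ‖(c - 2 * π * Complex.I * t : ℂ)‖ := by
  have := Complex.abs_re_le_norm (c - 2 * π * Complex.I * t : ℂ)
  simp at this
  exact (le_abs_self c).trans this

lemma den_ne {c : ℝ} (hc : 0 < c) (t : ℝ) : (c - 2 * π * Complex.I * t : ℂ) ≠ 0 := by
  intro h
  have := norm_den_ge' hc t
  rw [h, norm_zero] at this
  linarith

lemma Kdel_norm_le {δ t : ℝ} (ht : t ≠ 0) : ‖Kdel δ t‖ ≤ 2 * |t|⁻¹ := by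
  have h0 : 0 < |t| := abs_pos.2 ht
  have h1 : ∀ c : ℝ, ‖(c - 2 * π * Complex.I * t : ℂ)⁻¹‖ ≤ |t|⁻¹ := by
    intro c
    rw [norm_inv]
    exact inv_anti₀ h0 (norm_den_ge c t)
  unfold Kdel
  refine (norm_sub_le _ _).trans ?_
  linarith [h1 δ, h1 δ⁻¹]

lemma Kdel_cont {δ : ℝ} (hδ : 0 < δ) : Continuous (Kdel δ) := by
  unfold Kdel
  apply Continuous.sub
  · exact Continuous.inv₀ (by fun_prop) (fun t => den_ne hδ t)
  · exact Continuous.inv₀ (by fun_prop) (fun t => den_ne (inv_pos.2 hδ) t)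

lemma Kdel_int {δ : ℝ} (hδ : 0 < δ) : Integrable (Kdel δ) := by
  let C : ℝ := |δ⁻¹ - δ| * ((min (1/2) (δ/2)) ^ 1)⁻¹ * ((min (1/2) (δ⁻¹/2)))⁻¹
  have hlow : ∀ c : ℝ, 0 < c → ∀ t : ℝ, min (1/2) (c/2) * √(1 + t ^ 2) ≤ ‖(c - 2 * π * Complex.I * t : ℂ)‖ := by
    intro c hc t
    have h1 := norm_den_ge c t
    have h2 := norm_den_ge' hc t
    have h3 : √(1 + t ^ 2) ≤ 1 + |t| := by
      rw [Real.sqrt_le_left (by positivity)]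
      nlinarith [abs_nonneg t, sq_abs t]
    have h4 : 0 < min (1/2) (c/2) := by positivity
    calc _ ≤ min (1/2) (c/2) * (1 + |t|) := by gcongr
      _ = min (1/2) (c/2) * 1 + min (1/2) (c/2) * |t| := by ring
      _ ≤ (c/2) * 1 + (1/2) * |t| := by
        gcongr
        · exact min_le_right _ _
        · exact min_le_left _ _
      _ ≤ _ := by linarith
  have hb : ∀ t, ‖Kdel δ t‖ ≤ C * (1 + t ^ 2)⁻¹ := by
    intro t
    have e : Kdel δ t = ((δ⁻¹ - δ : ℝ) : ℂ) * ((δ : ℂ) - 2 * π * Complex.I * t)⁻¹ * (((δ⁻¹ : ℝ) : ℂ) - 2 * π * Complex.I * t)⁻¹ := by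
      unfold Kdel
      rw [inv_sub_inv (den_ne hδ t) (den_ne (inv_pos.2 hδ) t), div_eq_mul_inv, mul_inv, mul_assoc _ (_⁻¹)]
      congr 1
      push_cast; ring
    rw [e, norm_mul, norm_mul, norm_inv, norm_inv, Complex.norm_real, Real.norm_eq_abs]
    have h1 := hlow δ hδ t
    have h2 := hlow δ⁻¹ (inv_pos.2 hδ) t
    have hs : 0 < √(1 + t ^ 2) := by positivity
    have hδ' := inv_pos.2 hδ
    calc _ ≤ |δ⁻¹ - δ| * (min (1/2) (δ/2) * √(1 + t ^ 2))⁻¹ * (min (1/2) (δ⁻¹/2) * √(1 + t ^ 2))⁻¹ := by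
          gcongr
      _ = C * (√(1 + t ^ 2) * √(1 + t ^ 2))⁻¹ := by
          simp only [C, mul_inv, pow_one]; ring
      _ = _ := by rw [Real.mul_self_sqrt (by positivity)]
  exact (integrable_inv_one_add_sq.const_mul C).mono' (Kdel_cont hδ).aestronglyMeasurable
    (Eventually.of_forall hb)

lemma Kdel_fourier {δ : ℝ} (hδ : 0 < δ) : 𝓕 (Kdel δ) = fun s => (mdel δ s : ℂ) := by
  have hc : Continuous (fun s => (mdel δ s : ℂ)) := Complex.continuous_ofReal.comp (mdel_cont δ)
  have := hc.fourier_fourierInv_eq (mdel_int hδ)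
    (by
      have h : 𝓕 (fun s => (mdel δ s : ℂ)) = fun w => Kdel δ (-w) := by
        ext w
        rw [← mdel_fourierInv hδ, Real.fourierInv_eq_fourier_neg, neg_neg]
      rw [h]; exact (Kdel_int hδ).comp_neg)
  rwa [mdel_fourierInv hδ] at this

lemma mdel_tendsto {s : ℝ} (hs : 0 < s) : Tendsto (fun δ => mdel δ s) (𝓝[>] 0) (𝓝 1) := by
  have h1 : Tendsto (fun δ : ℝ => Real.exp (-(δ * max s 0))) (𝓝[>] 0) (𝓝 1) := by
    have : ContinuousAt (fun δ : ℝ => Real.exp (-(δ * max s 0))) 0 := by fun_prop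
    have h := this.tendsto.mono_left (nhdsWithin_le_nhds (s := Set.Ioi 0))
    simpa using h
  have h2 : Tendsto (fun δ : ℝ => Real.exp (-(δ⁻¹ * max s 0))) (𝓝[>] 0) (𝓝 0) := by
    apply Real.tendsto_exp_neg_atTop_nhds_zero.comp
    exact tendsto_inv_nhdsGT_zero.atTop_mul_const (by rw [max_eq_left hs.le]; exact hs)
  simpa [mdel] using h1.sub h2

lemma Kdel_tendsto {t : ℝ} (ht : t ≠ 0) :
    Tendsto (fun δ => Kdel δ t) (𝓝[>] 0) (𝓝 (Complex.I / (2 * π * t))) := by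
  have hπ : (π : ℂ) ≠ 0 := by exact_mod_cast Real.pi_ne_zero
  have ht' : (t : ℂ) ≠ 0 := by exact_mod_cast ht
  have h1 : Tendsto (fun δ : ℝ => ((δ : ℂ) - 2 * π * Complex.I * t)⁻¹) (𝓝[>] 0) (𝓝 (Complex.I / (2 * π * t))) := by
    have : ContinuousAt (fun δ : ℝ => ((δ : ℂ) - 2 * π * Complex.I * t)⁻¹) 0 := by
      apply ContinuousAt.inv₀ (by fun_prop)
      simp [ht, Real.pi_ne_zero]
    have h := this.tendsto.mono_left (nhdsWithin_le_nhds (s := Set.Ioi 0))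
    convert h using 2
    simp only [Complex.ofReal_zero, zero_sub]
    field_simp
    simp
  have h2 : Tendsto (fun δ : ℝ => (((δ⁻¹ : ℝ) : ℂ) - 2 * π * Complex.I * t)⁻¹) (𝓝[>] 0) (𝓝 0) := by
    apply squeeze_zero_norm' (a := fun δ : ℝ => δ)
    · filter_upwards [self_mem_nhdsWithin] with δ hδ
      rw [norm_inv]
      have := norm_den_ge' (inv_pos.2 hδ) t
      have h3 := inv_anti₀ (inv_pos.2 hδ) this
      rwa [inv_inv] at h3
    · exact nhdsWithin_le_nhds
  simpa [Kdel] using h1.sub h2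
end

section
open MeasureTheory Real FourierTransform Filter Topology

noncomputable def KH (a b θ : ℝ) (x : Plane) : ℂ :=
  ∫ t : ℝ, (Complex.I / (2 * π * t)) * ann a b (x - t • vv θ)

noncomputable def Tdel (δ a b θ : ℝ) (x : Plane) : ℂ :=
  ∫ t : ℝ, Kdel δ t * ann a b (x - t • vv θ)

lemma measurable_line (θ : ℝ) : Measurable (fun t : ℝ => t • vv θ) := by
  apply Continuous.measurable; fun_prop

/-- On the support of the integrand, `t` is bounded below and localised. -/
lemma line_supp {a b θ t : ℝ} {x : Plane} (hx : 2 * b < ‖x‖) (h : ann a b (x - t • vv θ) ≠ 0) :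
    b < |t| ∧ |t - inner ℝ (vv θ) x| < b ∧ |t| ≤ ‖x‖ + b := by
  have hb : ‖x - t • vv θ‖ < b := by
    by_contra h'
    exact h (ann_eq_zero (not_lt.1 h'))
  have hn : ‖t • vv θ‖ = |t| := by rw [norm_smul, norm_vv, mul_one, Real.norm_eq_abs]
  have h1 := norm_sub_norm_le x (t • vv θ)
  have h2 := norm_sub_norm_le (t • vv θ) x
  rw [norm_sub_rev] at h2
  rw [hn] at h1 h2
  refine ⟨by linarith, ?_, by linarith⟩
  have h3 : inner ℝ (vv θ) (x - t • vv θ) = inner ℝ (vv θ) x - t := by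
    rw [inner_sub_right, inner_smul_right, real_inner_self_eq_norm_sq, norm_vv]; ring
  have h4 := abs_real_inner_le_norm (vv θ) (x - t • vv θ)
  rw [h3, norm_vv, one_mul, abs_sub_comm] at h4
  linarith

lemma dom_bound {a b θ t : ℝ} {x : Plane} {k : ℂ} (ha : 0 < a) (hb : 0 < b) (hx : 2 * b < ‖x‖)
    (hk : t ≠ 0 → ‖k‖ ≤ 2 * |t|⁻¹) : ‖k * ann a b (x - t • vv θ)‖ ≤
      Set.indicator (Metric.ball (inner ℝ (vv θ) x) b) (fun _ => 2 * b⁻¹ * a⁻¹) t := by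
  by_cases h : ann a b (x - t • vv θ) = 0
  · rw [h, mul_zero, norm_zero]
    exact Set.indicator_nonneg (fun _ _ => by positivity) _
  · obtain ⟨h1, h2, -⟩ := line_supp hx h
    rw [Set.indicator_of_mem (by simpa [Metric.mem_ball, Real.dist_eq] using h2), norm_mul]
    have ht : t ≠ 0 := by rintro rfl; simp at h1; linarith
    have h3 : ‖k‖ ≤ 2 * b⁻¹ := (hk ht).trans (by gcongr)
    have h4 := norm_ann_le (b := b) ha (x - t • vv θ)
    gcongr

lemma dom_int {b c p : ℝ} :
    Integrable (Set.indicator (Metric.ball p b) (fun _ : ℝ => c)) := by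
  rw [integrable_indicator_iff measurableSet_ball]
  exact integrableOn_const measure_ball_lt_top.ne

lemma dom_int_val {b c p : ℝ} (hb : 0 < b) :
    ∫ t, (Set.indicator (Metric.ball p b) (fun _ : ℝ => c)) t = 2 * b * c := by
  rw [integral_indicator_const _ measurableSet_ball, Measure.real, Real.volume_ball,
    ENNReal.toReal_ofReal (by linarith), smul_eq_mul]

lemma KH_norm_k (t : ℝ) (_ : t ≠ 0) : ‖(Complex.I / (2 * π * t) : ℂ)‖ ≤ 2 * |t|⁻¹ := by
  rw [norm_div, norm_mul, norm_mul, Complex.norm_I, Complex.norm_real, Complex.norm_real]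
  simp only [Complex.norm_ofNat, norm_eq_abs, abs_of_pos Real.pi_pos]
  rw [one_div, mul_inv]
  have h3 := Real.pi_gt_three
  have : (2 * π)⁻¹ ≤ 2 := by
    rw [inv_le_comm₀ (by positivity) (by positivity)]; linarith
  gcongr

lemma bound_val {a b : ℝ} {x : Plane} {θ : ℝ} (ha : 0 < a) (hb : 0 < b) (hx : 2 * b < ‖x‖)
    {k : ℝ → ℂ} (hk : ∀ t, t ≠ 0 → ‖k t‖ ≤ 2 * |t|⁻¹) :
    ‖∫ t : ℝ, k t * ann a b (x - t • vv θ)‖ ≤ 4 * a⁻¹ := by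
  refine (norm_integral_le_of_norm_le dom_int
    (Eventually.of_forall fun t => dom_bound ha hb hx (hk t))).trans ?_
  rw [dom_int_val hb]
  apply le_of_eq; field_simp; ring

lemma line_meas {k : ℝ → ℂ} (hk : Measurable k) (a b θ : ℝ) :
    Measurable (fun p : Plane × ℝ => k p.2 * ann a b (p.1 - p.2 • vv θ)) := by
  apply (hk.comp measurable_snd).mul
  exact (measurable_ann a b).comp (measurable_fst.sub ((measurable_line θ).comp measurable_snd))

lemma KHk_meas : Measurable (fun t : ℝ => (Complex.I / (2 * π * t) : ℂ)) := by fun_prop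

lemma KH_meas (a b θ : ℝ) : StronglyMeasurable (KH a b θ) :=
  (line_meas KHk_meas a b θ).stronglyMeasurable.integral_prod_right

lemma Tdel_tendsto {a b : ℝ} {x : Plane} (θ : ℝ) (ha : 0 < a) (hb : 0 < b) (hx : 2 * b < ‖x‖) :
    Tendsto (fun δ => Tdel δ a b θ x) (𝓝[>] 0) (𝓝 (KH a b θ x)) := by
  apply tendsto_integral_filter_of_dominated_convergence
    (Set.indicator (Metric.ball (inner ℝ (vv θ) x) b) (fun _ => 2 * b⁻¹ * a⁻¹))
  · filter_upwards [self_mem_nhdsWithin] with δ hδ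
    exact ((line_meas (Kdel_cont hδ).measurable a b θ).comp
      (measurable_const.prodMk measurable_id)).aestronglyMeasurable
  · filter_upwards with δ
    exact Eventually.of_forall fun t => dom_bound ha hb hx Kdel_norm_le
  · exact dom_int
  · refine Eventually.of_forall fun t => ?_
    by_cases ht : ann a b (x - t • vv θ) = 0
    · simp [ht]
    · obtain ⟨h1, -⟩ := line_supp hx ht
      have ht : t ≠ 0 := by rintro rfl; simp at h1; linarith
      exact (Kdel_tendsto ht).mul_const _

lemma halfPlane_meas (θ : ℝ) : MeasurableSet (halfPlane θ) := by
  have : halfPlane θ = {x : Plane | 0 ≤ inner ℝ (vv θ) x} := by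
    ext x; simp [halfPlane, inner_vv]
  rw [this]
  exact measurableSet_le measurable_const (by apply Continuous.measurable; fun_prop)

lemma bdry_null (θ : ℝ) : ∀ᵐ ξ : Plane, inner ℝ (vv θ) ξ ≠ 0 := by
  have h := Measure.addHaar_submodule (volume : Measure Plane) (LinearMap.ker (innerₗ Plane (vv θ)))
    (by
      intro h
      have : vv θ ∈ LinearMap.ker (innerₗ Plane (vv θ)) := by rw [h]; trivial
      rw [LinearMap.mem_ker, innerₗ_apply_apply, real_inner_self_eq_norm_sq, norm_vv] at this
      norm_num at this)
  rw [ae_iff]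
  convert h using 2
  ext ξ
  simp

lemma weak_formula {a b : ℝ} (θ : ℝ) (ha : 0 < a) (hb : 0 < b) (φ : SchwartzMap Plane ℂ)
    (hφ : ∀ x : Plane, ‖x‖ ≤ 2 * b → 𝓕 (φ : Plane → ℂ) x = 0) :
    ∫ ξ, (Set.indicator (halfPlane θ) (fun _ => 1) ξ * 𝓕 (ann a b) ξ) * φ ξ =
      ∫ x, KH a b θ x * 𝓕 (φ : Plane → ℂ) x := by
  have hfi : Integrable (ann a b) := ann_integrable ha
  have hφi : Integrable (𝓕 (φ : Plane → ℂ)) := by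
    rw [← SchwartzMap.fourier_coe]; exact SchwartzMap.integrable _
  have hle : ∀ δ > 0, ∫ ξ, ((mdel δ (inner ℝ (vv θ) ξ) : ℂ) * 𝓕 (ann a b) ξ) * φ ξ =
      ∫ x, Tdel δ a b θ x * 𝓕 (φ : Plane → ℂ) x := by
    intro δ hδ
    obtain ⟨g1, g2⟩ := genConv (Kdel_int hδ) (measurable_line θ) (measurable_ann a b) hfi
    have := fourier_swap g1 (φ.integrable (μ := volume))
    unfold Tdel
    rw [← this]
    congr 1; ext ξ
    rw [g2 ξ]
    congr 2
    rw [← congrFun (Kdel_fourier hδ) (inner ℝ (vv θ) ξ), Real.fourier_eq]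
    congr 1; ext t
    simp only [inner_smul_left]
    congr 3
    simp [mul_comm]
  have hev : ∀ᶠ δ : ℝ in 𝓝[>] 0, 0 < δ := self_mem_nhdsWithin
  have lim1 : Tendsto (fun δ => ∫ ξ, ((mdel δ (inner ℝ (vv θ) ξ) : ℂ) * 𝓕 (ann a b) ξ) * φ ξ)
      (𝓝[>] 0) (𝓝 (∫ ξ, (Set.indicator (halfPlane θ) (fun _ => 1) ξ * 𝓕 (ann a b) ξ) * φ ξ)) := by
    apply tendsto_integral_filter_of_dominated_convergence
      (fun ξ => (∫ y, ‖ann a b y‖) * ‖φ ξ‖)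
    · filter_upwards with δ
      apply Continuous.aestronglyMeasurable
      have h1 := mdel_cont δ
      have h2 := continuous_fourier hfi
      have h3 := φ.continuous
      fun_prop
    · filter_upwards [hev] with δ hδ
      refine Eventually.of_forall fun ξ => ?_
      rw [norm_mul, norm_mul, Complex.norm_real, Real.norm_eq_abs]
      have := mdel_abs (s := inner ℝ (vv θ) ξ) hδ
      have h2 := norm_fourier_le (f := ann a b) ξ
      calc _ ≤ 1 * (∫ y, ‖ann a b y‖) * ‖φ ξ‖ := by gcongr
        _ = _ := by ring
    · exact φ.integrable.norm.const_mul _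
    · filter_upwards [bdry_null θ] with ξ hξ
      refine Tendsto.mul_const _ (Tendsto.mul_const _ ?_)
      rcases lt_or_gt_of_ne hξ with h | h
      · have h1 : ξ ∉ halfPlane θ := by
          simp only [halfPlane, Set.mem_ofPred_eq, ← inner_vv, not_le]; exact h
        rw [Set.indicator_of_notMem h1]
        simp only [mdel_of_nonpos h.le]
        simp
      · have h1 : ξ ∈ halfPlane θ := by
          simp only [halfPlane, Set.mem_ofPred_eq, ← inner_vv]; exact h.le
        rw [Set.indicator_of_mem h1]
        have := (Complex.continuous_ofReal.tendsto 1).comp (mdel_tendsto h)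
        simpa [Function.comp_def] using this
  have lim2 : Tendsto (fun δ => ∫ x, Tdel δ a b θ x * 𝓕 (φ : Plane → ℂ) x)
      (𝓝[>] 0) (𝓝 (∫ x, KH a b θ x * 𝓕 (φ : Plane → ℂ) x)) := by
    apply tendsto_integral_filter_of_dominated_convergence
      (fun x => 4 * a⁻¹ * ‖𝓕 (φ : Plane → ℂ) x‖)
    · filter_upwards [hev] with δ hδ
      refine AEStronglyMeasurable.mul ?_ hφi.aestronglyMeasurable
      exact (line_meas (Kdel_cont hδ).measurable a b
        θ).stronglyMeasurable.integral_prod_right.aestronglyMeasurable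
    · filter_upwards with δ
      refine Eventually.of_forall fun x => ?_
      by_cases hx : ‖x‖ ≤ 2 * b
      · rw [hφ x hx]; simp
      · rw [norm_mul]
        gcongr
        exact bound_val ha hb (not_le.1 hx) (fun t => Kdel_norm_le)
    · exact hφi.norm.const_mul _
    · refine Eventually.of_forall fun x => ?_
      by_cases hx : ‖x‖ ≤ 2 * b
      · rw [hφ x hx]; simp
      · exact (Tdel_tendsto θ ha hb (not_le.1 hx)).mul_const _
  refine tendsto_nhds_unique lim1 (lim2.congr' ?_)
  filter_upwards [hev] with δ hδ
  exact (hle δ hδ).symm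

lemma h_structure {a b θ : ℝ} (ha : 0 < a) (hb : 0 < b) {g h : Plane → ℂ} (hg1 : Integrable g)
    (hg2 : MemLp g 2) (hh : MemLp h 2)
    (hF : HasFourierTransform h
      (fun ξ => Set.indicator (halfPlane θ) (fun _ => 1) ξ * 𝓕 g ξ)) :
    ∃ E : Plane → ℂ, MemLp E 2 ∧ ∫ x, ‖E x‖ ^ 2 ≤ ∫ x, ‖g x - ann a b x‖ ^ 2 ∧
      ∀ᵐ x : Plane, 2 * b < ‖x‖ → h x = KH a b θ x + E x := by
  have hfi : Integrable (ann a b) := ann_integrable ha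
  have hD1 : Integrable (fun x => g x - ann a b x) := hg1.sub hfi
  have hD2 : MemLp (fun x => g x - ann a b x) 2 := hg2.sub (ann_memLp ha 2)
  obtain ⟨E, hE2, hEn, hEF⟩ := L2mult hD1 hD2 (halfPlane_meas θ)
  refine ⟨E, hE2, hEn, ?_⟩
  have hU : IsOpen {x : Plane | 2 * b < ‖x‖} := isOpen_lt continuous_const continuous_norm
  have hloc : LocallyIntegrable (fun x => h x - E x) volume :=
    (hh.sub hE2).locallyIntegrable (by norm_num)
  have hUm := hU.measurableSet
  have hKloc : LocallyIntegrableOn (KH a b θ) {x : Plane | 2 * b < ‖x‖} := by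
    have hbd : LocallyIntegrable (Set.indicator {x : Plane | 2 * b < ‖x‖} (KH a b θ)) volume := by
      have : LocallyIntegrable (fun _ : Plane => 4 * a⁻¹) volume := locallyIntegrable_const _
      refine this.mono ((KH_meas a b θ).aestronglyMeasurable.indicator hUm)
        (Eventually.of_forall fun x => ?_)
      rw [Real.norm_of_nonneg (by positivity)]
      by_cases hx : x ∈ {x : Plane | 2 * b < ‖x‖}
      · rw [Set.indicator_of_mem hx]
        exact bound_val ha hb hx KH_norm_k
      · rw [Set.indicator_of_notMem hx, norm_zero]; positivity
    intro x hx
    obtain ⟨s, hs, hs2⟩ := hbd x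
    refine ⟨s ∩ {x : Plane | 2 * b < ‖x‖}, inter_mem (mem_nhdsWithin_of_mem_nhds hs)
      self_mem_nhdsWithin, ?_⟩
    have h3 : IntegrableOn (KH a b θ) ({x : Plane | 2 * b < ‖x‖} ∩ s) volume := by
      have h4 : Integrable (Set.indicator {x : Plane | 2 * b < ‖x‖} (KH a b θ))
        (volume.restrict s) := hs2
      rw [integrable_indicator_iff hUm, IntegrableOn, Measure.restrict_restrict hUm] at h4
      exact h4
    rwa [Set.inter_comm]
  have key := hU.ae_eq_zero_of_integral_contDiff_smul_eq_zero (μ := volume)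
    (f := fun x => (h x - E x) - KH a b θ x) ((hloc.locallyIntegrableOn _).sub hKloc) (by
    intro ψ hψ hψc hψU
    have hg₁ : HasCompactSupport (Complex.ofRealCLM ∘ ψ) := hψc.comp_left rfl
    have hg₂ : ContDiff ℝ (⊤ : ℕ∞) (Complex.ofRealCLM ∘ ψ) := by fun_prop
    let χ : SchwartzMap Plane ℂ := hg₁.toSchwartzMap hg₂
    have hχ : ∀ x, χ x = (ψ x : ℂ) := fun x => rfl
    let φ : SchwartzMap Plane ℂ := 𝓕⁻ χ
    have hφ : 𝓕 (φ : Plane → ℂ) = χ := by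
      rw [← SchwartzMap.fourier_coe, fourier_fourierInv_eq]
    have hz : ∀ x : Plane, ‖x‖ ≤ 2 * b → 𝓕 (φ : Plane → ℂ) x = 0 := by
      intro x hx
      rw [hφ, hχ]
      have : ψ x = 0 := by
        by_contra hne
        have := hψU (subset_tsupport ψ hne)
        simp only [Set.mem_ofPred_eq] at this
        linarith
      simp [this]
    have w1 := weak_formula θ ha hb φ hz
    have w2 := hEF φ
    have w3 := hF φ
    have hFg : ∀ ξ, 𝓕 g ξ = 𝓕 (ann a b) ξ + 𝓕 (fun x => g x - ann a b x) ξ := by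
      intro ξ
      have e : 𝓕 (fun x => ann a b x + (g x - ann a b x)) ξ =
        𝓕 (ann a b) ξ + 𝓕 (fun x => g x - ann a b x) ξ := by
        have := VectorFourier.fourierIntegral_add (L := innerₗ Plane) Real.continuous_fourierChar
          continuous_inner hfi hD1
        exact (congrFun this ξ)
      rw [← e]; congr 1; simp
    have bint : ∀ F : Plane → ℂ, Integrable F →
        Integrable (fun ξ => (Set.indicator (halfPlane θ) (fun _ => 1) ξ * 𝓕 F ξ) * φ ξ) := by
      intro F hF
      refine (φ.integrable (μ := volume)).bdd_mul (c := ∫ y, ‖F y‖) ?_ ?_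
      · exact (aestronglyMeasurable_const.indicator (halfPlane_meas θ)).mul
          (continuous_fourier hF).aestronglyMeasurable
      · refine Eventually.of_forall fun ξ => ?_
        by_cases hξ : ξ ∈ halfPlane θ
        · simp [hξ, norm_fourier_le]
        · simp [hξ]; exact integral_nonneg fun _ => norm_nonneg _
    have hsum : ∫ ξ, (Set.indicator (halfPlane θ) (fun _ => 1) ξ * 𝓕 g ξ) * φ ξ =
      (∫ x, KH a b θ x * 𝓕 (φ : Plane → ℂ) x) + ∫ x, E x * 𝓕 (fun y => φ y) x := by
      rw [w2, ← w1, ← integral_add (bint _ hfi) (bint _ hD1)]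
      congr 1; ext ξ; rw [hFg]; ring
    rw [hsum] at w3
    change ∫ x, h x * 𝓕 (φ : Plane → ℂ) x =
      (∫ x, KH a b θ x * 𝓕 (φ : Plane → ℂ) x) + ∫ x, E x * 𝓕 (φ : Plane → ℂ) x at w3
    have hχ2 : MemLp (χ : Plane → ℂ) 2 := χ.memLp 2
    rw [hφ] at w3 hz
    have ih : Integrable (fun x => h x * χ x) := hh.integrable_mul hχ2
    have iE : Integrable (fun x => E x * χ x) := hE2.integrable_mul hχ2
    have iK : Integrable (fun x => KH a b θ x * χ x) := by
      refine ((χ.integrable (μ := volume)).norm.const_mul (4 * a⁻¹)).mono'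
        ((KH_meas a b θ).aestronglyMeasurable.mul χ.continuous.aestronglyMeasurable)
        (Eventually.of_forall fun x => ?_)
      by_cases hx : ‖x‖ ≤ 2 * b
      · rw [hz x hx]; simp
      · rw [norm_mul]
        gcongr
        exact bound_val ha hb (not_le.1 hx) KH_norm_k
    have e : ∀ x, ψ x • ((h x - E x) - KH a b θ x) =
        h x * χ x - E x * χ x - KH a b θ x * χ x := by
      intro x; rw [hχ, Complex.real_smul]; ring
    simp only [e]
    have ihE : Integrable (fun x => h x * χ x - E x * χ x) := ih.sub iE
    rw [integral_sub ihE iK, integral_sub ih iE, w3]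
    ring)
  filter_upwards [key] with x hx hxU
  have := hx hxU
  linear_combination this
end

section
open MeasureTheory Real FourierTransform Filter Topology

lemma exists_angle {N : ℕ} (hN : 0 < N) (x : Plane) :
    ∃ k : Fin N, |x 1 * cos (π * ((k : ℕ) + 1) / N) - x 0 * sin (π * ((k : ℕ) + 1) / N)| ≤
      ‖x‖ * (π / N) := by
  have hN' : (0:ℝ) < N := by exact_mod_cast hN
  set z : ℂ := ⟨x 0, x 1⟩ with hz
  have hzn : ‖z‖ = ‖x‖ := by
    rw [EuclideanSpace.norm_eq, Complex.norm_eq_sqrt_sq_add_sq]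
    simp [Fin.sum_univ_two, hz]
  have h0 : x 0 = ‖x‖ * cos z.arg := by rw [← hzn, Complex.norm_mul_cos_arg]
  have h1 : x 1 = ‖x‖ * sin z.arg := by rw [← hzn, Complex.norm_mul_sin_arg]
  set α := z.arg
  set q : ℤ := ⌊α * N / π⌋
  have hNz : (0:ℤ) < N := by exact_mod_cast hN
  have hk0 : 0 ≤ (q - 1) % (N:ℤ) := Int.emod_nonneg _ hNz.ne'
  have hk1 : (q - 1) % (N:ℤ) < N := Int.emod_lt_of_pos _ hNz
  have hk2 := Int.emod_add_mul_ediv (q - 1) (N:ℤ)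
  obtain ⟨k, hk⟩ := Int.eq_ofNat_of_zero_le hk0
  set j : ℤ := (q - 1) / (N:ℤ)
  rw [hk] at hk1 hk2
  refine ⟨⟨k, by exact_mod_cast hk1⟩, ?_⟩
  have hk3 : (k:ℝ) + N * j = q - 1 := by exact_mod_cast hk2
  have hθ : π * ((k:ℝ) + 1) / N = π * q / N - j * π := by
    field_simp; linear_combination hk3
  have e : x 1 * cos (π * ((k : ℕ) + 1) / N) - x 0 * sin (π * ((k : ℕ) + 1) / N) =
      ‖x‖ * sin ((α - π * q / N) + j * π) := by
    have : (α - π * q / N) + j * π = α - π * ((k : ℝ) + 1) / N := by rw [hθ]; ring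
    rw [this, sin_sub]
    nth_rw 1 [h1]; nth_rw 1 [h0]; ring
  simp only [e]
  rw [abs_mul, abs_of_nonneg (norm_nonneg x)]
  gcongr
  rw [Real.sin_add_int_mul_pi, abs_mul, abs_zpow, abs_neg, abs_one, one_zpow, one_mul]
  refine Real.abs_sin_le_abs.trans ?_
  have f1 := Int.floor_le (α * N / π)
  have f2 := Int.lt_floor_add_one (α * N / π)
  change (q:ℝ) ≤ _ at f1
  change _ < (q:ℝ) + 1 at f2
  have e2 : α - π * q / N = (α * N / π - q) * (π / N) := by field_simp
  rw [e2, abs_mul, abs_of_pos (by positivity : 0 < π / N)]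
  have : |α * N / π - q| ≤ 1 := by rw [abs_le]; constructor <;> linarith
  nlinarith [show 0 < π / N by positivity]

lemma norm_line (θ t : ℝ) (x : Plane) : ‖x - t • vv θ‖ ^ 2 =
    (t - inner ℝ (vv θ) x) ^ 2 + (x 1 * cos θ - x 0 * sin θ) ^ 2 := by
  rw [inner_vv, EuclideanSpace.norm_sq_eq]
  simp only [Fin.sum_univ_two, Real.norm_eq_abs, sq_abs, vv, PiLp.sub_apply, PiLp.smul_apply,
    smul_eq_mul]
  simp only [PiLp.toLp_apply, Matrix.cons_val_zero, Matrix.cons_val_one]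
  linear_combination (t ^ 2 - x 0 ^ 2 - x 1 ^ 2) * sin_sq_add_cos_sq θ

lemma ann_ofReal (a b : ℝ) (x : Plane) : ann a b x = ((‖ann a b x‖ : ℝ) : ℂ) := by
  unfold ann
  split_ifs <;> simp

lemma KH_lower {a b θ m : ℝ} {x : Plane} (ha : 0 < a) (hb : 0 < b) (hx : 2 * b < ‖x‖)
    (ham : a ≤ m) (hmb : 2 * m ≤ b) (hd : |x 1 * cos θ - x 0 * sin θ| ≤ m) :
    log (b / (2 * m)) / (8 * π * ‖x‖) ≤ ‖KH a b θ x‖ := by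
  have hm : 0 < m := ha.trans_le ham
  have hxp : 0 < ‖x‖ := by linarith
  set p : ℝ := inner ℝ (vv θ) x with hp
  set d := x 1 * cos θ - x 0 * sin θ with hdd
  have hd2 : d ^ 2 ≤ m ^ 2 := by rw [← sq_abs]; gcongr
  have hpb : b < |p| := by
    have := norm_line θ 0 x
    rw [zero_smul, sub_zero, zero_sub, neg_sq, ← hp, ← hdd] at this
    apply lt_of_pow_lt_pow_left₀ 2 (abs_nonneg _)
    rw [sq_abs]
    nlinarith
  obtain ⟨σ, hσ2, hσp, hσa⟩ : ∃ σ : ℝ, σ ^ 2 = 1 ∧ σ * p = |p| ∧ |σ| = 1 := by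
    rcases le_total 0 p with h | h
    · exact ⟨1, by norm_num, by rw [abs_of_nonneg h, one_mul], by norm_num⟩
    · exact ⟨-1, by norm_num, by rw [abs_of_nonpos h]; ring, by norm_num⟩
  set F : ℝ → ℝ := fun t => t⁻¹ * ‖ann a b (x - t • vv θ)‖ with hF
  have hKF : KH a b θ x = (Complex.I / (2 * π)) * ((∫ t, F t : ℝ) : ℂ) := by
    rw [KH, ← integral_complex_ofReal, ← integral_const_mul]
    congr 1; ext t
    rw [ann_ofReal, hF]; push_cast
    rw [div_mul_eq_div_div, div_eq_mul_inv _ (t:ℂ)]; ring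
  have hFi : Integrable F := by
    refine (dom_int (b := b) (c := 2 * b⁻¹ * a⁻¹) (p := p)).mono' ?_
      (Eventually.of_forall fun t => ?_)
    · refine Measurable.aestronglyMeasurable ?_
      refine measurable_inv.mul (((measurable_ann a b).comp ?_).norm)
      exact measurable_const.sub (measurable_line θ)
    · have := dom_bound (k := ((t⁻¹ : ℝ) : ℂ)) (θ := θ) (t := t) ha hb hx (fun _ => by
        rw [Complex.norm_real, Real.norm_eq_abs, abs_inv]
        have : 0 ≤ |t|⁻¹ := by positivity
        linarith)
      refine le_trans (le_of_eq ?_) this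
      rw [norm_mul, norm_mul, Complex.norm_real, norm_norm]
  set G : ℝ → ℝ := fun t => (4 * ‖x‖)⁻¹ * (t - p)⁻¹ with hG
  have hGi : IntervalIntegrable G volume (p + m) (p + b / 2) := by
    apply ContinuousOn.intervalIntegrable
    intro t ht
    rw [Set.uIcc_of_le (by linarith)] at ht
    have : t - p ≠ 0 := by have := ht.1; intro h; linarith
    apply ContinuousAt.continuousWithinAt
    fun_prop (disch := assumption)
  have hGv : ∫ t in (p + m)..(p + b / 2), G t = (4 * ‖x‖)⁻¹ * log (b / (2 * m)) := by
    rw [hG, intervalIntegral.integral_const_mul,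
      intervalIntegral.integral_comp_sub_right (fun s => s⁻¹) p, integral_inv_of_pos (by linarith)
      (by linarith)]
    rw [add_sub_cancel_left, add_sub_cancel_left, div_div]
  have hle : ∀ t, Set.indicator (Set.Ioc (p + m) (p + b / 2)) G t ≤ σ * F t := by
    intro t
    by_cases h0 : ann a b (x - t • vv θ) = 0
    · have : t ∉ Set.Ioc (p + m) (p + b / 2) := by
        intro ht
        have hn := norm_line θ t x
        rw [← hp, ← hdd] at hn
        have h1 : m < t - p := by linarith [ht.1]
        have h2 : t - p ≤ b / 2 := by linarith [ht.2]
        have h3 : a ≤ ‖x - t • vv θ‖ := by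
          apply le_of_sq_le_sq _ (norm_nonneg _)
          nlinarith
        have h4 : ‖x - t • vv θ‖ < b := by
          apply lt_of_pow_lt_pow_left₀ 2 hb.le
          nlinarith
        rw [ann, if_pos ⟨h3, h4⟩] at h0
        have h5 : (0:ℝ) < ‖x - t • vv θ‖⁻¹ := by
          have := ha.trans_le h3
          positivity
        exact h5.ne' (by exact_mod_cast h0)
      rw [Set.indicator_of_notMem this]
      simp [hF, h0]
    · obtain ⟨h1, h2, h3⟩ := line_supp hx h0
      rw [← hp] at h2
      have h4 : 0 < σ * t := by
        have : σ * t = |p| + σ * (t - p) := by rw [← hσp]; ring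
        have h5 := neg_abs_le (σ * (t - p))
        rw [abs_mul, hσa, one_mul] at h5
        linarith
      have h5 : σ * t = |t| := by rw [← abs_of_pos h4, abs_mul, hσa, one_mul]
      have h6 : σ * t⁻¹ = (|t|)⁻¹ := by
        rw [← h5, mul_inv]
        congr 1
        rw [eq_comm, inv_eq_of_mul_eq_one_left]; nlinarith
      have h7 : (2 * ‖x‖)⁻¹ ≤ |t|⁻¹ := by
        apply inv_anti₀ (by linarith) (by linarith)
      have h8 : σ * F t = |t|⁻¹ * ‖ann a b (x - t • vv θ)‖ := by
        rw [hF, ← h6]; ring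
      rw [h8]
      by_cases ht : t ∈ Set.Ioc (p + m) (p + b / 2)
      · rw [Set.indicator_of_mem ht]
        have hn := norm_line θ t x
        rw [← hp, ← hdd] at hn
        have k1 : m < t - p := by linarith [ht.1]
        have k2 : t - p ≤ b / 2 := by linarith [ht.2]
        have k3 : ‖x - t • vv θ‖ ≤ 2 * (t - p) := by
          apply le_of_sq_le_sq _ (by linarith)
          nlinarith
        have k4 : ‖ann a b (x - t • vv θ)‖ = ‖x - t • vv θ‖⁻¹ ∧ 0 < ‖x - t • vv θ‖ := by
          unfold ann at h0 ⊢
          split_ifs at h0 ⊢ with hc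
          · refine ⟨?_, ha.trans_le hc.1⟩
            rw [Complex.norm_real, norm_inv, norm_norm]
          · exact absurd rfl h0
        rw [k4.1]
        have k5 : (2 * (t - p))⁻¹ ≤ ‖x - t • vv θ‖⁻¹ := inv_anti₀ k4.2 k3
        have k6 : G t = (2 * ‖x‖)⁻¹ * (2 * (t - p))⁻¹ := by
          simp only [hG, mul_inv]; ring
        rw [k6]
        have : 0 < 2 * (t - p) := by linarith
        gcongr
      · rw [Set.indicator_of_notMem ht]; positivity
  have hInteg : (4 * ‖x‖)⁻¹ * log (b / (2 * m)) ≤ σ * ∫ t, F t := by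
    rw [← hGv, intervalIntegral.integral_of_le (by linarith), ← integral_indicator
      measurableSet_Ioc, ← integral_const_mul]
    refine integral_mono ?_ (hFi.const_mul σ) hle
    rw [integrable_indicator_iff measurableSet_Ioc]
    exact (intervalIntegrable_iff_integrableOn_Ioc_of_le (by linarith)).1 hGi
  have habs : σ * ∫ t, F t ≤ |∫ t, F t| := by
    refine (le_abs_self _).trans ?_
    rw [abs_mul, hσa, one_mul]
  have hK : ‖KH a b θ x‖ = (2 * π)⁻¹ * |∫ t, F t| := by
    rw [hKF, norm_mul, Complex.norm_real, norm_div, Complex.norm_I, norm_mul, Complex.norm_real,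
      Real.norm_eq_abs, Real.norm_eq_abs, abs_of_pos pi_pos, one_div]
    simp
  rw [hK]
  calc log (b / (2 * m)) / (8 * π * ‖x‖) = (2 * π)⁻¹ * ((4 * ‖x‖)⁻¹ * log (b / (2 * m))) := by
        field_simp; ring
    _ ≤ _ := by gcongr; exact hInteg.trans habs
end

section
open MeasureTheory Real FourierTransform Filter Topology

lemma ann_sq {s t : ℝ} (hs : 0 < s) (hst : s ≤ t) :
    ∫ x, ‖ann s t x‖ ^ 2 = 2 * kap * log (t / s) := by
  have e : ∀ x : Plane, ‖ann s t x‖ ^ 2 =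
      (fun r => Set.indicator (Set.Ico s t) (fun r : ℝ => r⁻¹ ^ 2) r) ‖x‖ := by
    intro x
    unfold ann
    by_cases h : s ≤ ‖x‖ ∧ ‖x‖ < t
    · rw [if_pos h]
      simp only []
      rw [Set.indicator_of_mem (show ‖x‖ ∈ Set.Ico s t from h)]
      rw [Complex.norm_real, norm_inv, norm_norm]
    · rw [if_neg h]
      simp only []
      rw [Set.indicator_of_notMem (show ‖x‖ ∉ Set.Ico s t from h)]
      simp
  simp only [e]
  rw [integral_fun_norm_addHaar volume (fun r => Set.indicator (Set.Ico s t)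
    (fun r : ℝ => r⁻¹ ^ 2) r)]
  have e2 : ∀ y : ℝ, y ^ (Module.finrank ℝ Plane - 1) • Set.indicator (Set.Ico s t)
    (fun r : ℝ => r⁻¹ ^ 2) y = Set.indicator (Set.Ico s t) (fun r : ℝ => r⁻¹) y := by
    intro y
    by_cases hy : y ∈ Set.Ico s t
    · have : y ≠ 0 := (hs.trans_le hy.1).ne'
      rw [Set.indicator_of_mem hy, Set.indicator_of_mem hy]
      simp
      field_simp
    · rw [Set.indicator_of_notMem hy, Set.indicator_of_notMem hy, smul_zero]
  simp only [e2]
  have hsub : Set.Ioi (0:ℝ) ∩ Set.Ico s t = Set.Ico s t :=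
    Set.inter_eq_right.2 (fun y hy => Set.mem_Ioi.2 (hs.trans_le hy.1))
  rw [setIntegral_indicator measurableSet_Ico, hsub, integral_Ico_eq_integral_Ioc, ← intervalIntegral.integral_of_le hst,
    integral_inv_of_pos hs (hs.trans_le hst), ← kap]
  simp
  ring

lemma KH_big {N : ℕ} (hN : 160000 < N) {x : Plane} (h1 : 3 * (N:ℝ) ^ (-8:ℤ) ≤ ‖x‖)
    (h2 : ‖x‖ < (N:ℝ) ^ (-8:ℤ) * √N) :
    ∃ k : Fin N, (32 * π)⁻¹ * log N * ‖x‖⁻¹ ≤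
      ‖KH (10 * (N:ℝ) ^ (-9:ℤ)) ((N:ℝ) ^ (-8:ℤ)) (π * ((k : ℕ) + 1) / N) x‖ := by
  have hN0 : 0 < N := by omega
  have hNr : (160000:ℝ) < N := by exact_mod_cast hN
  have hNp : (0:ℝ) < N := by linarith
  obtain ⟨k, hk⟩ := exists_angle hN0 x
  refine ⟨k, ?_⟩
  set b := (N:ℝ) ^ (-8:ℤ) with hb
  have hbp : 0 < b := by positivity
  set s := √(N:ℝ) with hs
  have hss : s * s = N := Real.mul_self_sqrt hNp.le
  have hs400 : 400 ≤ s := by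
    rw [hs]; apply Real.le_sqrt_of_sq_le; linarith
  have hsp : 0 < s := by linarith
  have hab : (N:ℝ) ^ (-9:ℤ) = b / N := by
    rw [hb, show (-9:ℤ) = -8 - 1 by norm_num, zpow_sub_one₀ hNp.ne']; rfl
  have hm1 : 10 * (N:ℝ) ^ (-9:ℤ) ≤ 10 * b / s := by
    rw [hab, ← hss, ← mul_div_assoc]
    gcongr
    nlinarith
  have hm2 : 2 * (10 * b / s) ≤ b := by
    rw [← mul_div_assoc, div_le_iff₀ hsp]; nlinarith
  have hm3 : ‖x‖ * (π / N) ≤ 10 * b / s := by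
    calc ‖x‖ * (π / N) ≤ (b * s) * (10 / N) := by
          have := Real.pi_le_four
          gcongr
          linarith
      _ = 10 * b / s := by rw [← hss]; field_simp
  have hxp : 0 < ‖x‖ := by linarith
  refine le_trans ?_ (KH_lower (by positivity) hbp (by linarith) hm1 hm2 (hk.trans hm3))
  have e1 : b / (2 * (10 * b / s)) = s / 20 := by field_simp; norm_num
  rw [e1, Real.log_div hsp.ne' (by norm_num), hs, Real.log_sqrt hNp.le]
  have : 4 * log 20 ≤ log N := by
    have : 4 * log 20 = log (20 ^ 4) := by rw [Real.log_pow]; norm_num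
    rw [this]
    apply Real.log_le_log (by norm_num); linarith
  rw [le_div_iff₀ (by positivity)]
  have : (32 * π)⁻¹ * log N * ‖x‖⁻¹ * (8 * π * ‖x‖) = log N / 4 := by
    field_simp; ring
  rw [this]; linarith

lemma main_lower {N : ℕ} (hN : 160000 < N) {g : Plane → ℂ} (hg1 : Integrable g)
    (hg2 : MemLp g 2) (h : Fin N → Plane → ℂ)
    (hh : ∀ k, MemLp (h k) 2 (volume : Measure Plane))
    (hF : ∀ k : Fin N, HasFourierTransform (h k)
      (fun ξ => Set.indicator (halfPlane (π * ((k : ℕ) + 1) / N)) (fun _ => 1) ξ * 𝓕 g ξ)) :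
    ((32 * π)⁻¹ * log N) ^ 2 * (kap * log N / 4) ≤
      (∫ x, ‖⨆ k : Fin N, ‖h k x‖‖ ^ 2) + N * ∫ x, ‖g x - demeterF N x‖ ^ 2 := by
  have hNr : (160000:ℝ) < N := by exact_mod_cast hN
  have hNp : (0:ℝ) < N := by linarith
  have : Nonempty (Fin N) := ⟨⟨0, by omega⟩⟩
  have ha : 0 < 10 * (N:ℝ) ^ (-9:ℤ) := by positivity
  have hb : 0 < (N:ℝ) ^ (-8:ℤ) := by positivity
  have hst := fun k => h_structure ha hb hg1 hg2 (hh k) (hF k)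
  choose E hE2 hEn hEae using hst
  set b := (N:ℝ) ^ (-8:ℤ) with hbdef
  have hs400 : 400 ≤ √(N:ℝ) := by
    apply Real.le_sqrt_of_sq_le; linarith
  have h3b : 0 < 3 * b := by positivity
  set S : Plane → ℝ := fun x => ⨆ k : Fin N, ‖h k x‖ with hS
  have hSk : ∀ x k, ‖h k x‖ ≤ S x := fun x k => 
    le_ciSup (f := fun k : Fin N => ‖h k x‖) (Set.finite_range _).bddAbove k
  have hS0 : ∀ x, 0 ≤ S x := fun x => (norm_nonneg _).trans (hSk x (Classical.arbitrary _))
  have hsq : ∀ {F : Plane → ℂ}, MemLp F 2 → Integrable (fun x => ‖F x‖ ^ 2) := fun hF =>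
    hF.integrable_norm_pow (by norm_num)
  have hSi : Integrable (fun x => ‖S x‖ ^ 2) := by
    refine (integrable_finsetSum Finset.univ (fun k _ => hsq (hh k))).mono' ?_
      (Eventually.of_forall fun x => ?_)
    · refine AEMeasurable.aestronglyMeasurable ?_
      have : AEMeasurable S := AEMeasurable.iSup fun k => (hh k).1.norm.aemeasurable
      exact this.norm.pow_const 2
    · obtain ⟨k, hk⟩ := exists_eq_ciSup_of_finite (f := fun k : Fin N => ‖h k x‖)
      have hk' : S x = ‖h k x‖ := hk.symm
      rw [hk', norm_norm, Real.norm_of_nonneg (by positivity)]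
      exact Finset.single_le_sum (f := fun k => ‖h k x‖ ^ 2) (fun _ _ => by positivity)
        (Finset.mem_univ k)
  have hEi : Integrable (fun x => ∑ k, ‖E k x‖ ^ 2) :=
    integrable_finsetSum Finset.univ (fun k _ => hsq (hE2 k))
  have hAi := hsq (ann_memLp (b := b * √N) h3b 2)
  have hpt : ∀ᵐ x : Plane, ((32 * π)⁻¹ * log N) ^ 2 * ‖ann (3 * b) (b * √N) x‖ ^ 2 ≤
      2 * ‖S x‖ ^ 2 + 2 * ∑ k, ‖E k x‖ ^ 2 := by
    filter_upwards [ae_all_iff.2 hEae] with x hx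
    have hsum0 : 0 ≤ ∑ k, ‖E k x‖ ^ 2 := Finset.sum_nonneg fun _ _ => by positivity
    by_cases hc : 3 * b ≤ ‖x‖ ∧ ‖x‖ < b * √N
    · obtain ⟨k, hk⟩ := KH_big hN hc.1 hc.2
      rw [ann, if_pos hc, Complex.norm_real, norm_inv, norm_norm, ← mul_pow]
      have e := hx k (by linarith [hc.1])
      have e1 : KH (10 * (N:ℝ) ^ (-9:ℤ)) b (π * ((k : ℕ) + 1) / N) x = h k x - E k x := by
        rw [e]; ring
      rw [← hbdef, e1] at hk
      have e2 : (32 * π)⁻¹ * log N * ‖x‖⁻¹ ≤ S x + ‖E k x‖ :=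
        hk.trans ((norm_sub_le _ _).trans (by gcongr; exact hSk x k))
      have e3 : ‖E k x‖ ^ 2 ≤ ∑ k, ‖E k x‖ ^ 2 :=
        Finset.single_le_sum (f := fun k => ‖E k x‖ ^ 2) (fun _ _ => by positivity)
          (Finset.mem_univ k)
      have hlog : 0 ≤ log N := Real.log_nonneg (by linarith)
      rw [Real.norm_of_nonneg (hS0 x)]
      calc _ ≤ (S x + ‖E k x‖) ^ 2 := by gcongr
        _ ≤ 2 * S x ^ 2 + 2 * ‖E k x‖ ^ 2 := by nlinarith [sq_nonneg (S x - ‖E k x‖)]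
        _ ≤ _ := by gcongr
    · rw [ann, if_neg hc]; simp; positivity
  have hI := integral_mono_ae (hAi.const_mul _) ((hSi.const_mul 2).add (hEi.const_mul 2)) hpt
  simp only [Pi.add_apply] at hI
  rw [integral_const_mul, integral_add (hSi.const_mul 2) (hEi.const_mul 2), integral_const_mul,
    integral_const_mul, integral_finsetSum _ (fun k _ => hsq (hE2 k)), ann_sq h3b (by nlinarith)]
    at hI
  have hEsum : ∑ k, ∫ x, ‖E k x‖ ^ 2 ≤ N * ∫ x, ‖g x - demeterF N x‖ ^ 2 := by
    refine (Finset.sum_le_sum fun k _ => hEn k).trans (le_of_eq ?_)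
    rw [Finset.sum_const, Finset.card_univ, Fintype.card_fin, nsmul_eq_mul]; rfl
  have hlog2 : log N / 4 ≤ log (b * √N / (3 * b)) := by
    have : b * √N / (3 * b) = √N / 3 := by field_simp
    rw [this, Real.log_div (by linarith) (by norm_num), Real.log_sqrt hNp.le]
    have : 4 * log 3 ≤ log N := by
      have : 4 * log 3 = log (3 ^ 4) := by rw [Real.log_pow]; norm_num
      rw [this]
      apply Real.log_le_log (by norm_num); linarith
    linarith
  have hfin : ((32 * π)⁻¹ * log N) ^ 2 * (2 * kap * (log N / 4)) ≤
      ((32 * π)⁻¹ * log N) ^ 2 * (2 * kap * log (b * √N / (3 * b))) := by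
    have := kap_pos
    gcongr
  linarith

lemma g_upper {N : ℕ} (hN : 160000 < N) {g : Plane → ℂ} (hg2 : MemLp g 2) :
    ∫ x, ‖g x‖ ^ 2 ≤ 4 * kap * log N + 2 * ∫ x, ‖g x - demeterF N x‖ ^ 2 := by
  have hNr : (160000:ℝ) < N := by exact_mod_cast hN
  have hNp : (0:ℝ) < N := by linarith
  have ha : 0 < 10 * (N:ℝ) ^ (-9:ℤ) := by positivity
  have hb : 0 < (N:ℝ) ^ (-8:ℤ) := by positivity
  have hsq : ∀ {F : Plane → ℂ}, MemLp F 2 → Integrable (fun x => ‖F x‖ ^ 2) := fun hF =>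
    hF.integrable_norm_pow (by norm_num)
  have hab : (N:ℝ) ^ (-8:ℤ) = (N:ℝ) ^ (-9:ℤ) * N := by
    rw [show (-8:ℤ) = -9 + 1 by norm_num, zpow_add_one₀ hNp.ne']
  have hf : MemLp (demeterF N) 2 := ann_memLp ha 2
  have hfv : ∫ x, ‖demeterF N x‖ ^ 2 = 2 * kap * log ((N:ℝ) ^ (-8:ℤ) / (10 * (N:ℝ) ^ (-9:ℤ))) :=
    ann_sq ha (by rw [hab]; nlinarith [show 0 < (N:ℝ) ^ (-9:ℤ) by positivity])
  have e : (N:ℝ) ^ (-8:ℤ) / (10 * (N:ℝ) ^ (-9:ℤ)) = N / 10 := by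
    rw [hab]; have : (N:ℝ) ^ (-9:ℤ) ≠ 0 := by positivity
    field_simp
  have hd : Integrable (fun x => ‖g x - demeterF N x‖ ^ 2) := hsq (hg2.sub hf)
  have hI : ∫ x, ‖g x‖ ^ 2 ≤ ∫ x, (2 * ‖demeterF N x‖ ^ 2 + 2 * ‖g x - demeterF N x‖ ^ 2) := by
    refine integral_mono (hsq hg2) (((hsq hf).const_mul 2).add (hd.const_mul 2)) fun x => ?_
    have h1 : ‖g x‖ ≤ ‖demeterF N x‖ + ‖g x - demeterF N x‖ := by
      simpa using norm_add_le (demeterF N x) (g x - demeterF N x)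
    calc ‖g x‖ ^ 2 ≤ (‖demeterF N x‖ + ‖g x - demeterF N x‖) ^ 2 := by gcongr
      _ ≤ _ := by nlinarith [sq_nonneg (‖demeterF N x‖ - ‖g x - demeterF N x‖)]
  rw [integral_add ((hsq hf).const_mul 2) (hd.const_mul 2), integral_const_mul,
    integral_const_mul, hfv, e] at hI
  have hl : log (N / 10) ≤ log N := by
    apply Real.log_le_log (by positivity); linarith
  have := mul_le_mul_of_nonneg_left hl (mul_pos two_pos kap_pos).le
  linarith
end

/-- Smooth modification of Demeter's function: there is a radial `g ∈ L¹ ∩ L²(ℝ²)` whose Fourier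
transform is supported in `B(0, N¹⁵)`, with `‖g − f‖₂ ≤ C N⁻²`, still satisfying the logarithmic
lower bound for the maximal half-plane multiplier operator along `θ_k = πk/N`. -/
theorem statement6 :
    ∃ C c : ℝ, 0 < C ∧ 0 < c ∧ ∃ N₀ : ℕ, ∀ N : ℕ, N₀ < N →
      ∃ g : Plane → ℂ, Integrable g (volume : Measure Plane) ∧
        MemLp g 2 (volume : Measure Plane) ∧
        (∀ x y : Plane, ‖x‖ = ‖y‖ → g x = g y) ∧
        (∀ ξ : Plane, (N:ℝ) ^ 15 ≤ ‖ξ‖ → 𝓕 g ξ = 0) ∧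
        l2norm2 (fun x => g x - demeterF N x) ≤ C * (N:ℝ) ^ (-2 : ℤ) ∧
        (∀ h : Fin N → Plane → ℂ,
          (∀ k, MemLp (h k) 2 (volume : Measure Plane)) →
          (∀ k : Fin N, HasFourierTransform (h k)
            (fun ξ => Set.indicator (halfPlane (Real.pi * ((k : ℕ) + 1) / N)) (fun _ => 1) ξ *
              𝓕 g ξ)) →
          c * Real.log N * l2norm2 g ≤ l2norm2 (fun x => ⨆ k : Fin N, ‖h k x‖)) := by
  obtain ⟨C, hC, hg⟩ := exists_g
  have hk := kap_pos
  set c₁ : ℝ := (32 * π)⁻¹ with hc₁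
  have hc₁p : 0 < c₁ := by positivity
  set M : ℝ := 1 + C ^ 2 / kap + 8 * C ^ 2 / (c₁ ^ 2 * kap) with hM
  refine ⟨C, c₁ / 8, hC, by positivity, ⌈exp M⌉₊ + 160000, fun N hN => ?_⟩
  have hN1 : 160000 < N := by omega
  have hNr : (160000:ℝ) < N := by exact_mod_cast hN1
  have hNp : (0:ℝ) < N := by linarith
  have hL : M ≤ log N := by
    rw [Real.le_log_iff_exp_le hNp]
    refine (Nat.le_ceil _).trans ?_
    exact_mod_cast (by omega : ⌈exp M⌉₊ ≤ N)
  obtain ⟨g, hg1, hg2, hrad, hsupp, hclose⟩ := hg N (by omega)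
  refine ⟨g, hg1, hg2, hrad, hsupp, ?_, fun h hh hF => ?_⟩
  · rw [l2norm2, ← Real.sqrt_eq_rpow]
    exact Real.sqrt_le_iff.2 ⟨by positivity, hclose⟩
  have hlow := main_lower hN1 hg1 hg2 h hh hF
  have hup := g_upper hN1 hg2
  rw [l2norm2, l2norm2, ← Real.sqrt_eq_rpow, ← Real.sqrt_eq_rpow]
  set D := ∫ x, ‖g x - demeterF N x‖ ^ 2 with hD
  set L := log (N:ℝ) with hLdef
  rw [← hc₁] at hlow
  have hz : (C * (N:ℝ) ^ (-2:ℤ)) ^ 2 = C ^ 2 / N ^ 4 := by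
    rw [zpow_neg, mul_pow]; norm_cast; field_simp; push_cast; ring
  rw [hz] at hclose
  have hD1 : N * D ≤ C ^ 2 := by
    calc N * D ≤ N * (C ^ 2 / N ^ 4) := by gcongr
      _ = C ^ 2 / N ^ 3 := by field_simp
      _ ≤ C ^ 2 := div_le_self (by positivity) (one_le_pow₀ (by linarith))
  have hD0 : 0 ≤ D := integral_nonneg fun _ => by positivity
  have hD2 : D ≤ C ^ 2 := by nlinarith
  have q1 : 0 ≤ C ^ 2 / kap := by positivity
  have q2 : 0 ≤ 8 * C ^ 2 / (c₁ ^ 2 * kap) := by positivity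
  have hL1 : 1 ≤ L := by linarith
  have hL2 : C ^ 2 ≤ kap * L := by
    have : C ^ 2 / kap ≤ L := by linarith
    rw [div_le_iff₀ hk] at this; linarith
  have hL3 : 8 * C ^ 2 ≤ c₁ ^ 2 * kap * L := by
    have : 8 * C ^ 2 / (c₁ ^ 2 * kap) ≤ L := by linarith
    rw [div_le_iff₀ (by positivity)] at this; linarith
  have hL4 : c₁ ^ 2 * kap * L ≤ c₁ ^ 2 * kap * L ^ 3 := by
    gcongr; exact le_self_pow₀ hL1 (by norm_num)
  have hgu : ∫ x, ‖g x‖ ^ 2 ≤ 6 * kap * L := by linarith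
  apply Real.le_sqrt_of_sq_le
  rw [mul_pow, Real.sq_sqrt (integral_nonneg fun _ => by positivity)]
  calc (c₁ / 8 * L) ^ 2 * ∫ x, ‖g x‖ ^ 2 ≤ (c₁ / 8 * L) ^ 2 * (6 * kap * L) := by gcongr
    _ = 6 / 64 * (c₁ ^ 2 * kap * L ^ 3) := by ring
    _ ≤ _ := by nlinarith [show 0 < c₁ ^ 2 * kap * L ^ 3 by positivity]
end

section
/- There exists an absolute constant C > 0 such that the following holds. Let δ > 0, let f ∈ L²(ℝ²) be supported in the ball B(0,δ), let θ be any angle, and let A ≥ 2δ. If h ∈ L²(ℝ²) is the function whose Fourier transform satisfies 𝓕h = 𝟙_{Γ_θ}·𝓕f almost everywhere, then ‖ h·𝟙_{{x : ‖x‖ ≥ A}} ‖_{L²(ℝ²)} ≤ C·√(δ/A)·‖f‖_{L²(ℝ²)}. -/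
open MeasureTheory Real FourierTransform

lemma aux_L2_norm (g : Lp (α := Plane) ℂ 2 volume) : ∫ x, ‖g x‖ ^ 2 = ‖g‖ ^ 2 := by
  have h1 : inner ℂ g g = ((∫ x, ‖g x‖ ^ 2 : ℝ) : ℂ) := by
    rw [MeasureTheory.L2.inner_def, ← integral_complex_ofReal]
    refine integral_congr_ae (Filter.Eventually.of_forall fun x => ?_)
    simp only
    rw [inner_self_eq_norm_sq_to_K]
    simp
  rw [inner_self_eq_norm_sq_to_K] at h1
  have h2 : (((‖g‖ ^ 2 : ℝ)) : ℂ) = ((∫ x, ‖g x‖ ^ 2 : ℝ) : ℂ) := by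
    rw [← h1]; simp
  exact (Complex.ofReal_injective h2).symm

lemma plancherel_weak {g u : Plane → ℂ} (hg : MemLp g 2 (volume : Measure Plane))
    (hu : LocallyIntegrable u volume) (H : HasFourierTransform g u) :
    MemLp u 2 (volume : Measure Plane) ∧ ∫ x, ‖u x‖ ^ 2 = ∫ x, ‖g x‖ ^ 2 := by
  set G : Lp (α := Plane) ℂ 2 volume := hg.toLp g with hG
  set U : Lp (α := Plane) ℂ 2 volume := 𝓕 G with hU
  have key : ∀ φ : SchwartzMap Plane ℂ, ∫ x, φ x • U x = ∫ x, φ x • u x := by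
    intro φ
    have h1 := Lp.fourier_toTemperedDistribution_eq G
    have h2 := congrArg (fun T => T φ) h1
    simp only [TemperedDistribution.fourier_apply, Lp.toTemperedDistribution_apply] at h2
    rw [hU, ← h2]
    have h3 := H φ
    simp only [smul_eq_mul]
    calc ∫ x, (𝓕 φ) x * G x = ∫ x : Plane, g x * 𝓕 (fun y => φ y) x := by
          refine integral_congr_ae ?_
          filter_upwards [hg.coeFn_toLp] with x hx
          rw [hG, hx, mul_comm, SchwartzMap.fourier_coe]
      _ = ∫ ξ : Plane, u ξ * φ ξ := h3
      _ = _ := by simp only [mul_comm]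
  have hUu : ∀ᵐ x, U x = u x := by
    refine ae_eq_of_integral_contDiff_smul_eq
      ((Lp.memLp U).locallyIntegrable (by norm_num)) hu ?_
    intro ψ hψ hc
    have hc' : HasCompactSupport (fun x => (ψ x : ℂ)) :=
      hc.comp_left (g := fun r : ℝ => (r : ℂ)) (by simp)
    have hd' : ContDiff ℝ (⊤ : ℕ∞) (fun x => (ψ x : ℂ)) :=
      Complex.ofRealCLM.contDiff.comp hψ
    have := key (hc'.toSchwartzMap hd')
    simpa using this
  have hm : MemLp u 2 (volume : Measure Plane) := (Lp.memLp U).ae_eq hUu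
  refine ⟨hm, ?_⟩
  have e1 : ∫ x, ‖u x‖ ^ 2 = ∫ x, ‖U x‖ ^ 2 := by
    refine integral_congr_ae ?_
    filter_upwards [hUu] with x hx
    rw [hx]
  have e2 : ∫ x, ‖g x‖ ^ 2 = ∫ x, ‖G x‖ ^ 2 := by
    refine integral_congr_ae ?_
    filter_upwards [hg.coeFn_toLp] with x hx
    rw [hG, hx]
  rw [e1, e2, aux_L2_norm, aux_L2_norm, hU, Lp.norm_fourier_eq]

lemma hasFT_of_integrable {f : Plane → ℂ} (hf : Integrable f volume) :
    HasFourierTransform f (𝓕 f) := by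
  intro φ
  have := VectorFourier.integral_fourierIntegral_smul_eq_flip (L := innerₗ Plane)
    (μ := volume) (ν := volume) (f := f) (g := φ)
    continuous_fourierChar continuous_inner hf φ.integrable
  simpa using! this.symm

lemma continuous_FT {f : Plane → ℂ} (hf : Integrable f volume) : Continuous (𝓕 f) :=
  VectorFourier.fourierIntegral_continuous (L := innerₗ Plane) continuous_fourierChar
    continuous_inner hf

lemma plancherel_L1L2 {f : Plane → ℂ} (hf : Integrable f volume)
    (hf2 : MemLp f 2 (volume : Measure Plane)) :
    MemLp (𝓕 f) 2 (volume : Measure Plane) ∧ ∫ x, ‖𝓕 f x‖ ^ 2 = ∫ x, ‖f x‖ ^ 2 :=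
  plancherel_weak hf2 (continuous_FT hf).locallyIntegrable (hasFT_of_integrable hf)

/-- the character -/
noncomputable def chr (w x : Plane) : ℂ := ((𝐞 (inner ℝ x w) : Circle) : ℂ)

lemma norm_chr (w x : Plane) : ‖chr w x‖ = 1 := Circle.norm_coe _

lemma continuous_chr (w : Plane) : Continuous (chr w) := by
  unfold chr
  have := continuous_fourierChar
  fun_prop

lemma chr_re (w x : Plane) : (chr w x).re = Real.cos (2 * π * inner ℝ x w) := by
  rw [chr, Real.fourierChar_apply]
  rw [Complex.exp_ofReal_mul_I_re]

lemma norm_chr_sub (w x : Plane) :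
    ‖chr w x - 1‖ ^ 2 = 2 - 2 * Real.cos (2 * π * inner ℝ x w) := by
  have h := norm_chr w x
  have h2 : ‖chr w x‖ ^ 2 = 1 := by rw [h]; norm_num
  rw [← chr_re, ← Complex.normSq_eq_norm_sq, Complex.normSq_apply]
  rw [← Complex.normSq_eq_norm_sq, Complex.normSq_apply] at h2
  simp only [Complex.sub_re, Complex.sub_im, Complex.one_re, Complex.one_im]
  nlinarith

lemma norm_chr_add (w x : Plane) :
    ‖chr w x + 1‖ ^ 2 = 2 + 2 * Real.cos (2 * π * inner ℝ x w) := by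
  have h := norm_chr w x
  have h2 : ‖chr w x‖ ^ 2 = 1 := by rw [h]; norm_num
  rw [← chr_re, ← Complex.normSq_eq_norm_sq, Complex.normSq_apply]
  rw [← Complex.normSq_eq_norm_sq, Complex.normSq_apply] at h2
  simp only [Complex.add_re, Complex.add_im, Complex.one_re, Complex.one_im]
  nlinarith

lemma memLp_chr_mul {h : Plane → ℂ} (hh : MemLp h 2 (volume : Measure Plane)) (w : Plane) :
    MemLp (fun x => chr w x * h x) 2 (volume : Measure Plane) := by
  refine hh.of_le ((continuous_chr w).aestronglyMeasurable.mul hh.1) ?_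
  refine Filter.Eventually.of_forall fun x => ?_
  rw [norm_mul, norm_chr, one_mul]

lemma hasFT_mod {h u : Plane → ℂ} (H : HasFourierTransform h u) (w : Plane) :
    HasFourierTransform (fun x => chr w x * h x) (fun ξ => u (ξ - w)) := by
  intro φ
  have h1 := H (SchwartzMap.compSubConstCLM ℂ (-w) φ)
  have h2 : ∫ ξ : Plane, u (ξ - w) * φ ξ = ∫ ξ : Plane, u ξ * φ (ξ + w) := by
    rw [← integral_add_right_eq_self (fun ξ : Plane => u (ξ - w) * φ ξ) w]
    simp
  rw [h2]
  simp only [SchwartzMap.compSubConstCLM_apply, sub_neg_eq_add] at h1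
  rw [← h1]
  congr 1
  ext x
  have h3 := congrFun (VectorFourier.fourierIntegral_comp_add_right 𝐞 (volume : Measure Plane)
    (innerₗ Plane) (fun y => φ y) w) x
  have h4 : 𝓕 (fun y => φ (y + w)) x = chr w x * 𝓕 (fun y => φ y) x := by
    refine Eq.trans h3 ?_
    rw [Circle.smul_def, smul_eq_mul, chr, innerₗ_apply_apply, real_inner_comm]
    rfl
  rw [h4]; ring

lemma hasFT_sub {h h' u u' : Plane → ℂ} (H : HasFourierTransform h u)
    (H' : HasFourierTransform h' u')
    (a : MemLp h 2 (volume : Measure Plane)) (a' : MemLp h' 2 (volume : Measure Plane))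
    (b : MemLp u 2 (volume : Measure Plane)) (b' : MemLp u' 2 (volume : Measure Plane)) :
    HasFourierTransform (fun x => h x - h' x) (fun x => u x - u' x) := by
  intro φ
  have e : (𝓕 (fun y => φ y) : Plane → ℂ) = (𝓕 φ : SchwartzMap Plane ℂ) := rfl
  have i1 : MemLp (𝓕 (fun y => φ y)) 2 (volume : Measure Plane) := by
    rw [e]; exact (𝓕 φ).memLp 2 volume
  have i2 : MemLp (fun y => φ y) 2 (volume : Measure Plane) := φ.memLp 2 volume
  simp only [sub_mul]
  have j1 : Integrable (fun x => h x * 𝓕 (fun y => φ y) x) volume := a.integrable_mul i1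
  have j2 : Integrable (fun x => h' x * 𝓕 (fun y => φ y) x) volume := a'.integrable_mul i1
  have j3 : Integrable (fun x => u x * φ x) volume := b.integrable_mul i2
  have j4 : Integrable (fun x => u' x * φ x) volume := b'.integrable_mul i2
  rw [integral_sub j1 j2, integral_sub j3 j4, H φ, H' φ]

lemma FT_translate_add {f : Plane → ℂ} (hf : Integrable f volume) (w ξ : Plane) :
    𝓕 (fun y => f (y + w) + f y) ξ = (chr w ξ + 1) * 𝓕 f ξ := by
  have h3 := congrFun (VectorFourier.fourierIntegral_comp_add_right 𝐞 (volume : Measure Plane)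
    (innerₗ Plane) f w) ξ
  have h5 := congrFun (VectorFourier.fourierIntegral_add (L := innerₗ Plane)
    continuous_fourierChar continuous_inner (hf.comp_add_right w) hf) ξ
  have h4 : VectorFourier.fourierIntegral 𝐞 volume (innerₗ Plane) (fun y => f (y + w)) ξ
      = chr w ξ * 𝓕 f ξ := by
    refine Eq.trans h3 ?_
    rw [Circle.smul_def, smul_eq_mul, chr, innerₗ_apply_apply, real_inner_comm]
    rfl
  refine h5.trans ?_
  rw [Pi.add_apply, h4, add_mul, one_mul]
  rfl

section gauss
variable {V : Type*} [NormedAddCommGroup V] [InnerProductSpace ℝ V] [FiniteDimensional ℝ V]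
  [MeasurableSpace V] [BorelSpace V]

lemma gauss_complex_eq (b : ℝ) (x v : V) :
    (Complex.exp (-(b : ℂ) * ‖v‖ ^ 2 + (2 * π * Complex.I) * (inner ℝ x v : ℝ))).re
      = rexp (-b * ‖v‖ ^ 2) * Real.cos (2 * π * inner ℝ x v) := by
  rw [Complex.exp_re]
  have h : (-(b : ℂ) * ‖v‖ ^ 2 + (2 * π * Complex.I) * (inner ℝ x v : ℝ))
      = ((-b * ‖v‖ ^ 2 : ℝ) : ℂ) + ((2 * π * inner ℝ x v : ℝ) : ℂ) * Complex.I := by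
    push_cast; ring
  rw [h, Complex.add_re, Complex.add_im, Complex.re_ofReal_mul, Complex.im_ofReal_mul]
  simp only [Complex.ofReal_re, Complex.ofReal_im, Complex.I_re, Complex.I_im]
  ring_nf

lemma gauss_cos_integrable {b : ℝ} (hb : 0 < b) (x : V) :
    Integrable (fun v : V => rexp (-b * ‖v‖ ^ 2) * Real.cos (2 * π * inner ℝ x v)) := by
  have hb' : 0 < (b : ℂ).re := by simpa using hb
  have := (GaussianFourier.integrable_cexp_neg_mul_sq_norm_add hb' (2 * π * Complex.I) x).re
  refine this.congr (Filter.Eventually.of_forall fun v => ?_)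
  exact gauss_complex_eq b x v

lemma gauss_integrable {b : ℝ} (hb : 0 < b) :
    Integrable (fun v : V => rexp (-b * ‖v‖ ^ 2)) := by
  simpa using gauss_cos_integrable hb (0 : V)

lemma gauss_cos {b : ℝ} (hb : 0 < b) (x : V) :
    ∫ v : V, rexp (-b * ‖v‖ ^ 2) * Real.cos (2 * π * inner ℝ x v) =
      (π / b) ^ (Module.finrank ℝ V / 2 : ℝ) * rexp (-(π ^ 2 * ‖x‖ ^ 2 / b)) := by
  have hb' : 0 < (b : ℂ).re := by simpa using hb
  have h1 := GaussianFourier.integral_cexp_neg_mul_sq_norm_add hb' (2 * π * Complex.I) x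
  have h2 := GaussianFourier.integrable_cexp_neg_mul_sq_norm_add hb' (2 * π * Complex.I) x
  have h3 := congrArg Complex.re h1
  have h4 := integral_re h2
  simp only [RCLike.re_eq_complex_re] at h4
  rw [← h4] at h3
  simp only [gauss_complex_eq] at h3
  rw [h3]
  have hbne : (b : ℂ) ≠ 0 := by exact_mod_cast hb.ne'
  have e1 : ((2 * π * Complex.I) ^ 2 * (‖x‖ : ℂ) ^ 2 / (4 * b))
      = ((-(π ^ 2 * ‖x‖ ^ 2 / b) : ℝ) : ℂ) := by
    push_cast
    rw [mul_pow, Complex.I_sq]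
    field_simp
    ring
  have e2 : ((π : ℂ) / b) ^ (Module.finrank ℝ V / 2 : ℂ)
      = (((π / b) ^ (Module.finrank ℝ V / 2 : ℝ) : ℝ) : ℂ) := by
    rw [Complex.ofReal_cpow (by positivity)]
    push_cast
    rfl
  rw [e1, e2, ← Complex.ofReal_exp, ← Complex.ofReal_mul, Complex.ofReal_re]

end gauss

lemma sqint {f : Plane → ℂ} (hf : MemLp f 2 (volume : Measure Plane)) :
    Integrable (fun x => ‖f x‖ ^ 2) volume := (memLp_two_iff_integrable_sq_norm hf.1).1 hf

lemma mul_bdd_integrable {p : Plane → ℝ} (hp : Integrable p volume) (q : Plane → ℝ)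
    (hq : Continuous q) (C : ℝ) (hC : ∀ x, |q x| ≤ C) :
    Integrable (fun x => q x * p x) volume :=
  hp.bdd_mul hq.aestronglyMeasurable (Filter.Eventually.of_forall hC)

lemma cos_corr_zero {f : Plane → ℂ} {δ : ℝ} (hf : Integrable f volume)
    (hf2 : MemLp f 2 (volume : Measure Plane))
    (hs : Function.support f ⊆ Metric.ball (0 : Plane) δ) (v : Plane) (hv : 2 * δ ≤ ‖v‖) :
    ∫ ξ, Real.cos (2 * π * inner ℝ ξ v) * ‖𝓕 f ξ‖ ^ 2 = 0 := by
  obtain ⟨hF, hN⟩ := plancherel_L1L2 hf hf2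
  have hsh : MemLp (fun y => f (y + v)) 2 (volume : Measure Plane) :=
    hf2.comp_measurePreserving (measurePreserving_add_right volume v)
  have h1 := (plancherel_L1L2 (f := fun y => f (y + v) + f y) ((hf.comp_add_right v).add hf)
    (hsh.add hf2)).2
  have h2 : ∫ y, ‖f (y + v) + f y‖ ^ 2 = 2 * ∫ y, ‖f y‖ ^ 2 := by
    have : ∀ y, ‖f (y + v) + f y‖ ^ 2 = ‖f (y + v)‖ ^ 2 + ‖f y‖ ^ 2 := by
      intro y
      by_cases hy : f y = 0
      · simp [hy]
      · have hy1 : ‖y‖ < δ := by simpa using hs hy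
        have hy2 : f (y + v) = 0 := by
          by_contra hne
          have hy3 : ‖y + v‖ < δ := by simpa using hs hne
          have : ‖v‖ ≤ ‖y + v‖ + ‖y‖ := by
            have := norm_sub_le (y + v) y
            simpa using this
          linarith
        simp [hy2]
    simp only [this]
    rw [integral_add (sqint hsh) (sqint hf2),
      integral_add_right_eq_self (fun y => ‖f y‖ ^ 2) v]
    ring
  rw [h2] at h1
  simp only [FT_translate_add hf, norm_mul, mul_pow, norm_chr_add] at h1
  have hi := sqint hF
  have hc : Integrable (fun ξ => Real.cos (2 * π * inner ℝ ξ v) * ‖𝓕 f ξ‖ ^ 2) volume :=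
    mul_bdd_integrable hi _ (by fun_prop) 1 (fun x => Real.abs_cos_le_one _)
  have h3 : ∫ ξ, (2 + 2 * Real.cos (2 * π * inner ℝ ξ v)) * ‖𝓕 f ξ‖ ^ 2
      = 2 * (∫ ξ, ‖𝓕 f ξ‖ ^ 2) + 2 * ∫ ξ, Real.cos (2 * π * inner ℝ ξ v) * ‖𝓕 f ξ‖ ^ 2 := by
    rw [← integral_const_mul, ← integral_const_mul,
      ← integral_add (hi.const_mul 2) (hc.const_mul 2)]
    congr 1; ext ξ; ring
  rw [h3, hN] at h1
  linarith

lemma cos_corr_le {f : Plane → ℂ} (hf : Integrable f volume)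
    (hf2 : MemLp f 2 (volume : Measure Plane)) (v : Plane) :
    ∫ ξ, Real.cos (2 * π * inner ℝ ξ v) * ‖𝓕 f ξ‖ ^ 2 ≤ ∫ x, ‖f x‖ ^ 2 := by
  obtain ⟨hF, hN⟩ := plancherel_L1L2 hf hf2
  have hi := sqint hF
  rw [← hN]
  refine integral_mono (mul_bdd_integrable hi _ (by fun_prop) 1 (fun x => Real.abs_cos_le_one _))
    hi (fun ξ => ?_)
  have := Real.cos_le_one (2 * π * inner ℝ ξ v)
  simp only
  nlinarith [sq_nonneg ‖𝓕 f ξ‖]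

lemma strip_bound {f : Plane → ℂ} {δ : ℝ} (hδ : 0 < δ) (hf : Integrable f volume)
    (hf2 : MemLp f 2 (volume : Measure Plane))
    (hs : Function.support f ⊆ Metric.ball (0 : Plane) δ) (e : Plane) (he : ‖e‖ = 1)
    {a : ℝ} (ha : 0 < a) :
    ∫ ξ, rexp (-(π * (inner ℝ ξ e) ^ 2 / a ^ 2)) * ‖𝓕 f ξ‖ ^ 2 ≤ 4 * δ * a * ∫ x, ‖f x‖ ^ 2 := by
  obtain ⟨hF, hN⟩ := plancherel_L1L2 hf hf2
  have hi := sqint hF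
  have hb : 0 < π * a ^ 2 := by positivity
  set N := ∫ x, ‖f x‖ ^ 2 with hNdef
  have hN0 : 0 ≤ N := integral_nonneg fun x => by positivity
  have hk : ∀ σ : ℝ, ∫ u : ℝ, a * (rexp (-(π * a ^ 2) * ‖u‖ ^ 2) * Real.cos (2 * π * inner ℝ σ u))
      = rexp (-(π * σ ^ 2 / a ^ 2)) := by
    intro σ
    rw [integral_const_mul, gauss_cos hb]
    have e1 : (π / (π * a ^ 2)) ^ (((Module.finrank ℝ ℝ : ℕ) : ℝ) / 2) = 1 / a := by
      have : π / (π * a ^ 2) = (1 / a) ^ (2 : ℝ) := by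
        rw [Real.rpow_two]; field_simp
      rw [this, ← Real.rpow_mul (by positivity)]
      simp
    rw [e1, ← mul_assoc, mul_one_div_cancel ha.ne', one_mul]
    congr 2
    rw [Real.norm_eq_abs, sq_abs]
    field_simp
  have hprod : Integrable (Function.uncurry fun (ξ : Plane) (u : ℝ) =>
      (a * (rexp (-(π * a ^ 2) * ‖u‖ ^ 2) * Real.cos (2 * π * inner ℝ (inner ℝ ξ e : ℝ) u)))
        * ‖𝓕 f ξ‖ ^ 2) (volume.prod volume) := by
    have h0 := (hi.mul_prod (gauss_integrable (V := ℝ) hb)).const_mul a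
    have h1 := h0.bdd_mul (c := 1)
      (f := fun p : Plane × ℝ => Real.cos (2 * π * inner ℝ (inner ℝ p.1 e : ℝ) p.2))
      (Continuous.aestronglyMeasurable (by fun_prop))
      (Filter.Eventually.of_forall fun p => Real.abs_cos_le_one _)
    refine h1.congr (Filter.Eventually.of_forall fun p => ?_)
    simp only [Function.uncurry]
    ring
  have hswap := integral_integral_swap hprod
  have hL : ∫ ξ, rexp (-(π * (inner ℝ ξ e) ^ 2 / a ^ 2)) * ‖𝓕 f ξ‖ ^ 2
      = ∫ u : ℝ, ∫ ξ : Plane, (a * (rexp (-(π * a ^ 2) * ‖u‖ ^ 2) *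
        Real.cos (2 * π * inner ℝ (inner ℝ ξ e : ℝ) u))) * ‖𝓕 f ξ‖ ^ 2 := by
    rw [← hswap]
    congr 1; ext ξ
    rw [integral_mul_const, hk]
  have hbound : ∀ u : ℝ, ∫ ξ : Plane, (a * (rexp (-(π * a ^ 2) * ‖u‖ ^ 2) *
        Real.cos (2 * π * inner ℝ (inner ℝ ξ e : ℝ) u))) * ‖𝓕 f ξ‖ ^ 2
      ≤ Set.indicator (Set.Icc (-(2 * δ)) (2 * δ)) (fun _ => a * N) u := by
    intro u
    have e1 : ∫ ξ : Plane, (a * (rexp (-(π * a ^ 2) * ‖u‖ ^ 2) *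
        Real.cos (2 * π * inner ℝ (inner ℝ ξ e : ℝ) u))) * ‖𝓕 f ξ‖ ^ 2
        = (a * rexp (-(π * a ^ 2) * ‖u‖ ^ 2)) *
          ∫ ξ, Real.cos (2 * π * inner ℝ ξ (u • e)) * ‖𝓕 f ξ‖ ^ 2 := by
      rw [← integral_const_mul]
      congr 1; ext ξ
      have : inner ℝ (inner ℝ ξ e : ℝ) u = inner ℝ ξ (u • e) := by
        rw [inner_smul_right]; simp
      rw [this]; ring
    rw [e1]
    by_cases hu : u ∈ Set.Icc (-(2 * δ)) (2 * δ)
    · rw [Set.indicator_of_mem hu]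
      have h1 := cos_corr_le hf hf2 (u • e)
      have h2 : rexp (-(π * a ^ 2) * ‖u‖ ^ 2) ≤ 1 := by
        rw [Real.exp_le_one_iff]
        have : 0 ≤ (π * a ^ 2) * ‖u‖ ^ 2 := by positivity
        linarith
      calc _ ≤ (a * rexp (-(π * a ^ 2) * ‖u‖ ^ 2)) * N := by gcongr
        _ ≤ (a * 1) * N := by gcongr
        _ = a * N := by ring
    · rw [Set.indicator_of_notMem hu, cos_corr_zero hf hf2 hs, mul_zero]
      rw [norm_smul, he, mul_one, Real.norm_eq_abs]
      by_contra hlt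
      push Not at hlt
      exact hu ⟨(abs_lt.1 hlt).1.le, (abs_lt.1 hlt).2.le⟩
  rw [hL]
  calc _ ≤ ∫ u : ℝ, Set.indicator (Set.Icc (-(2 * δ)) (2 * δ)) (fun _ => a * N) u := by
        refine integral_mono hprod.integral_prod_right ?_ hbound
        rw [integrable_indicator_iff measurableSet_Icc]
        exact integrableOn_const (by simp)
    _ = 4 * δ * a * N := by
        rw [integral_indicator measurableSet_Icc, setIntegral_const]
        simp only [Measure.real, Real.volume_Icc, smul_eq_mul]
        rw [ENNReal.toReal_ofReal (by linarith)]
        ring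

lemma mod_plancherel {h u : Plane → ℂ} (hh : MemLp h 2 (volume : Measure Plane))
    (hu : LocallyIntegrable u volume) (H : HasFourierTransform h u) (w : Plane) :
    MemLp (fun ξ => u (ξ - w) - u ξ) 2 (volume : Measure Plane) ∧
    ∫ ξ, ‖u (ξ - w) - u ξ‖ ^ 2 = ∫ x, (2 - 2 * Real.cos (2 * π * inner ℝ x w)) * ‖h x‖ ^ 2 := by
  have hu2 := (plancherel_weak hh hu H).1
  have hsh : MemLp (fun y => u (y - w)) 2 (volume : Measure Plane) :=
    hu2.comp_measurePreserving (measurePreserving_sub_right volume w)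
  have hm := memLp_chr_mul hh w
  have h1 := hasFT_sub (hasFT_mod H w) H hm hh hsh hu2
  have hd : MemLp (fun ξ => u (ξ - w) - u ξ) 2 (volume : Measure Plane) := hsh.sub hu2
  refine ⟨hd, ?_⟩
  rw [(plancherel_weak (hm.sub hh) (hd.locallyIntegrable (by norm_num)) h1).2]
  congr 1; ext x
  rw [← norm_chr_sub, ← mul_pow, ← norm_mul, sub_mul, one_mul]
  rfl

lemma two_sub_cos_le (y : ℝ) : 2 - 2 * Real.cos y ≤ 2 * |y| := by
  have h1 : Real.cos y = 1 - 2 * Real.sin (y / 2) ^ 2 := by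
    have := Real.cos_two_mul (y / 2)
    have h2 := Real.sin_sq_add_cos_sq (y / 2)
    rw [mul_div_cancel₀ y two_ne_zero] at this
    linarith
  have h2 : |Real.sin (y / 2)| ≤ |y / 2| := Real.abs_sin_le_abs
  have h3 : |Real.sin (y / 2)| ≤ 1 := Real.abs_sin_le_one _
  rw [abs_div, abs_two] at h2
  rw [h1, ← sq_abs]
  nlinarith [abs_nonneg (Real.sin (y / 2))]

lemma mod_bound {f h : Plane → ℂ} {δ θ : ℝ} (hδ : 0 < δ)
    (hf2 : MemLp f 2 (volume : Measure Plane))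
    (hs : Function.support f ⊆ Metric.ball (0 : Plane) δ)
    (hh : MemLp h 2 (volume : Measure Plane))
    (H : HasFourierTransform h
        (fun ξ => Set.indicator (halfPlane θ) (fun _ => 1) ξ * 𝓕 f ξ)) (w : Plane) :
    ∫ x, (2 - 2 * Real.cos (2 * π * inner ℝ x w)) * ‖h x‖ ^ 2 ≤
      (8 * π + 8 * rexp π) * δ * ‖w‖ * ∫ x, ‖f x‖ ^ 2 := by
  rcases eq_or_ne w 0 with rfl | hw
  · simp
  have ha : 0 < ‖w‖ := norm_pos_iff.2 hw
  have hf : Integrable f volume := by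
    rw [← integrableOn_iff_integrable_of_support_subset hs]
    have : IsFiniteMeasure ((volume : Measure Plane).restrict (Metric.ball 0 δ)) :=
      ⟨by
        rw [Measure.restrict_apply_univ]
        exact measure_ball_lt_top⟩
    exact (hf2.restrict _).integrable (by norm_num)
  obtain ⟨hF, hN⟩ := plancherel_L1L2 hf hf2
  have hi := sqint hF
  set F := 𝓕 f with hFdef
  have hFc : Continuous F := continuous_FT hf
  set N := ∫ x, ‖f x‖ ^ 2 with hNdef
  set χ : Plane → ℂ := Set.indicator (halfPlane θ) (fun _ => 1) with hχ
  set e : Plane := !₂[Real.cos θ, Real.sin θ] with he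
  have hin : ∀ x : Plane, inner ℝ x e = x 0 * Real.cos θ + x 1 * Real.sin θ := by
    intro x
    simp [he, PiLp.inner_apply, Fin.sum_univ_two, mul_comm]
  have hen : ‖e‖ = 1 := by
    rw [EuclideanSpace.norm_eq]
    simp [he, Fin.sum_univ_two]
  have hmem : ∀ x : Plane, x ∈ halfPlane θ ↔ 0 ≤ inner ℝ x e := by
    intro x; rw [hin]; rfl
  have hmeas : MeasurableSet (halfPlane θ) := by
    have : halfPlane θ = {x : Plane | 0 ≤ inner ℝ x e} := Set.ext hmem
    rw [this]
    exact (isClosed_le continuous_const (by fun_prop)).measurableSet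
  have hχm : Measurable χ := measurable_const.indicator hmeas
  have hχ1 : ∀ x, ‖χ x‖ ≤ 1 := by
    intro x
    by_cases hx : x ∈ halfPlane θ
    · simp [hχ, hx]
    · simp [hχ, hx]
  have hu2 : MemLp (fun ξ => χ ξ * F ξ) 2 (volume : Measure Plane) := by
    refine hF.of_le (hχm.aestronglyMeasurable.mul hF.1) (Filter.Eventually.of_forall fun x => ?_)
    rw [norm_mul]
    exact mul_le_of_le_one_left (norm_nonneg _) (hχ1 x)
  obtain ⟨hd, hdn⟩ := mod_plancherel hh (hu2.locallyIntegrable (by norm_num)) H w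
  obtain ⟨hdf, hdfn⟩ := mod_plancherel hf2 hFc.locallyIntegrable (hasFT_of_integrable hf) w
  have hG : Integrable (fun ξ => rexp (-(π * (inner ℝ ξ e) ^ 2 / ‖w‖ ^ 2)) * ‖F ξ‖ ^ 2) volume := by
    refine mul_bdd_integrable hi (fun ξ => rexp (-(π * (inner ℝ ξ e) ^ 2 / ‖w‖ ^ 2)))
      (by fun_prop) 1 (fun x => ?_)
    rw [abs_of_pos (Real.exp_pos _), Real.exp_le_one_iff]
    have : 0 ≤ π * (inner ℝ x e) ^ 2 / ‖w‖ ^ 2 := by positivity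
    linarith
  set g : Plane → ℝ := fun ξ => rexp (-(π * (inner ℝ ξ e) ^ 2 / ‖w‖ ^ 2)) * ‖F ξ‖ ^ 2 with hg
  have hGs : Integrable (fun ξ => g (ξ - w)) volume := hG.comp_sub_right w
  -- pointwise bound on the symmetric difference
  have hpt1 : ∀ ξ : Plane, ‖(χ ξ - χ (ξ + w)) * F ξ‖ ^ 2 ≤ rexp π * g ξ := by
    intro ξ
    rw [norm_mul, mul_pow, hg]
    simp only
    rw [← mul_assoc]
    gcongr
    rw [← Real.exp_add]
    have hwe : |inner ℝ w e| ≤ ‖w‖ := by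
      have := abs_real_inner_le_norm w e
      rwa [hen, mul_one] at this
    have hadd : inner ℝ (ξ + w) e = inner ℝ ξ e + inner ℝ w e := inner_add_left _ _ _
    by_cases hsm : |inner ℝ ξ e| ≤ ‖w‖
    · have h1 : ‖χ ξ - χ (ξ + w)‖ ≤ 1 := by
        by_cases h1 : ξ ∈ halfPlane θ <;> by_cases h2 : ξ + w ∈ halfPlane θ <;>
          simp [hχ, h1, h2]
      have h2 : 1 ≤ rexp (π + -(π * (inner ℝ ξ e) ^ 2 / ‖w‖ ^ 2)) := by
        rw [Real.one_le_exp_iff]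
        have h3 : (inner ℝ ξ e) ^ 2 ≤ ‖w‖ ^ 2 := by
          rw [← sq_abs]; gcongr
        have h4 : π * (inner ℝ ξ e) ^ 2 / ‖w‖ ^ 2 ≤ π := by
          rw [div_le_iff₀ (by positivity)]
          exact mul_le_mul_of_nonneg_left h3 Real.pi_pos.le
        linarith
      exact (pow_le_one₀ (norm_nonneg _) h1).trans h2
    · push Not at hsm
      have : (ξ ∈ halfPlane θ ↔ ξ + w ∈ halfPlane θ) := by
        rw [hmem, hmem, hadd]
        have := abs_le.1 hwe
        rcases lt_abs.1 hsm with h1 | h1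
        · exact ⟨fun _ => by linarith, fun _ => by linarith⟩
        · exact ⟨fun _ => by linarith, fun _ => by linarith⟩
      have h0 : χ ξ - χ (ξ + w) = 0 := by
        by_cases h1 : ξ ∈ halfPlane θ
        · simp [hχ, h1, this.1 h1]
        · have h2 : ξ + w ∉ halfPlane θ := fun h => h1 (this.2 h)
          simp [hχ, h1, h2]
      rw [h0]
      simp [Real.exp_nonneg]
  have hpt : ∀ ξ : Plane, ‖χ (ξ - w) * F (ξ - w) - χ ξ * F ξ‖ ^ 2 ≤
      2 * ‖F (ξ - w) - F ξ‖ ^ 2 + 2 * (rexp π * g (ξ - w)) := by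
    intro ξ
    have h1 := hpt1 (ξ - w)
    rw [sub_add_cancel] at h1
    have h2 : χ (ξ - w) * F (ξ - w) - χ ξ * F ξ
        = χ ξ * (F (ξ - w) - F ξ) + (χ (ξ - w) - χ ξ) * F (ξ - w) := by ring
    have h3 : ‖χ (ξ - w) * F (ξ - w) - χ ξ * F ξ‖
        ≤ ‖F (ξ - w) - F ξ‖ + ‖(χ (ξ - w) - χ ξ) * F (ξ - w)‖ := by
      rw [h2]
      refine (norm_add_le _ _).trans ?_
      gcongr
      rw [norm_mul]
      exact mul_le_of_le_one_left (norm_nonneg _) (hχ1 ξ)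
    have h4 := pow_le_pow_left₀ (norm_nonneg _) h3 2
    nlinarith [sq_nonneg (‖F (ξ - w) - F ξ‖ - ‖(χ (ξ - w) - χ ξ) * F (ξ - w)‖)]
  have hA : ∫ ξ, ‖F (ξ - w) - F ξ‖ ^ 2 ≤ 4 * π * δ * ‖w‖ * N := by
    rw [hdfn, hNdef, ← integral_const_mul]
    refine integral_mono (mul_bdd_integrable (sqint hf2)
      (fun x => 2 - 2 * Real.cos (2 * π * inner ℝ x w)) (by fun_prop) 4 (fun x => ?_))
      ((sqint hf2).const_mul _) (fun x => ?_)
    · rw [abs_le]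
      constructor <;> linarith [Real.cos_le_one (2 * π * inner ℝ x w),
        Real.neg_one_le_cos (2 * π * inner ℝ x w)]
    · simp only
      by_cases hx : f x = 0
      · simp [hx]
      · have hx1 : ‖x‖ < δ := by simpa using hs hx
        gcongr
        refine (two_sub_cos_le _).trans ?_
        rw [abs_mul, abs_of_pos (by positivity : 0 < 2 * π)]
        have h1 := abs_real_inner_le_norm x w
        have h2 : ‖x‖ * ‖w‖ ≤ δ * ‖w‖ := by gcongr
        have h3 : |inner ℝ x w| ≤ δ * ‖w‖ := h1.trans h2
        nlinarith [Real.pi_pos]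
  have hB : ∫ ξ, g (ξ - w) ≤ 4 * δ * ‖w‖ * N := by
    rw [integral_sub_right_eq_self g w]
    exact strip_bound hδ hf hf2 hs e hen ha
  rw [← hdn]
  calc ∫ ξ, ‖χ (ξ - w) * F (ξ - w) - χ ξ * F ξ‖ ^ 2
      ≤ ∫ ξ, (2 * ‖F (ξ - w) - F ξ‖ ^ 2 + 2 * (rexp π * g (ξ - w))) :=
        integral_mono (sqint hd) (((sqint hdf).const_mul 2).add ((hGs.const_mul _).const_mul 2)) hpt
    _ = 2 * (∫ ξ, ‖F (ξ - w) - F ξ‖ ^ 2) + 2 * (rexp π * ∫ ξ, g (ξ - w)) := by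
        rw [integral_add ((sqint hdf).const_mul 2) ((hGs.const_mul _).const_mul 2),
          integral_const_mul, integral_const_mul, integral_const_mul]
    _ ≤ 2 * (4 * π * δ * ‖w‖ * N) + 2 * (rexp π * (4 * δ * ‖w‖ * N)) := by gcongr
    _ = _ := by ring

lemma gauss2 {b : ℝ} (hb : 0 < b) (x : Plane) :
    ∫ v : Plane, rexp (-b * ‖v‖ ^ 2) * Real.cos (2 * π * inner ℝ x v) =
      (π / b) * rexp (-(π ^ 2 * ‖x‖ ^ 2 / b)) := by
  rw [gauss_cos hb]
  simp

lemma gauss2' {b : ℝ} (hb : 0 < b) : ∫ v : Plane, rexp (-b * ‖v‖ ^ 2) = π / b := by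
  simpa using gauss2 hb 0

lemma final_sq {f h : Plane → ℂ} {δ A θ : ℝ} (hδ : 0 < δ) (hA : 0 < A)
    (hf2 : MemLp f 2 (volume : Measure Plane))
    (hs : Function.support f ⊆ Metric.ball (0 : Plane) δ)
    (hh : MemLp h 2 (volume : Measure Plane))
    (H : HasFourierTransform h
        (fun ξ => Set.indicator (halfPlane θ) (fun _ => 1) ξ * 𝓕 f ξ)) :
    ∫ x, ‖Set.indicator {y : Plane | A ≤ ‖y‖} h x‖ ^ 2 ≤
      (2 * (8 * π + 8 * rexp π)) * (δ / A) * ∫ x, ‖f x‖ ^ 2 := by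
  set N := ∫ x, ‖f x‖ ^ 2 with hNdef
  have hN0 : 0 ≤ N := integral_nonneg fun x => by positivity
  set M := 8 * π + 8 * rexp π with hM
  have hM0 : 0 ≤ M := by positivity
  have hb : 0 < π * A ^ 2 := by positivity
  have hhi := sqint hh
  have hk : ∀ x : Plane, ∫ w : Plane, A ^ 2 * rexp (-(π * A ^ 2) * ‖w‖ ^ 2) *
      (2 - 2 * Real.cos (2 * π * inner ℝ x w)) = 2 - 2 * rexp (-(π * ‖x‖ ^ 2 / A ^ 2)) := by
    intro x
    have e1 : ∀ w : Plane, A ^ 2 * rexp (-(π * A ^ 2) * ‖w‖ ^ 2) *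
      (2 - 2 * Real.cos (2 * π * inner ℝ x w)) = (2 * A ^ 2) * rexp (-(π * A ^ 2) * ‖w‖ ^ 2)
       - (2 * A ^ 2) * (rexp (-(π * A ^ 2) * ‖w‖ ^ 2) * Real.cos (2 * π * inner ℝ x w)) := by
      intro w; ring
    simp only [e1]
    rw [integral_sub ((gauss_integrable hb).const_mul _) ((gauss_cos_integrable hb x).const_mul _),
      integral_const_mul, integral_const_mul, gauss2 hb, gauss2' hb]
    have e2 : π ^ 2 * ‖x‖ ^ 2 / (π * A ^ 2) = π * ‖x‖ ^ 2 / A ^ 2 := by field_simp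
    rw [e2]
    field_simp
  have hprod : Integrable (Function.uncurry fun (x : Plane) (w : Plane) =>
      (A ^ 2 * rexp (-(π * A ^ 2) * ‖w‖ ^ 2) * (2 - 2 * Real.cos (2 * π * inner ℝ x w)))
        * ‖h x‖ ^ 2) (volume.prod volume) := by
    have h0 := (hhi.mul_prod (gauss_integrable (V := Plane) hb)).const_mul (A ^ 2)
    have h1 := h0.bdd_mul (c := 4)
      (f := fun p : Plane × Plane => 2 - 2 * Real.cos (2 * π * inner ℝ p.1 p.2))
      (Continuous.aestronglyMeasurable (by fun_prop))
      (Filter.Eventually.of_forall fun p => by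
        rw [Real.norm_eq_abs, abs_le]
        constructor <;> linarith [Real.cos_le_one (2 * π * inner ℝ p.1 p.2),
          Real.neg_one_le_cos (2 * π * inner ℝ p.1 p.2)])
    refine h1.congr (Filter.Eventually.of_forall fun p => ?_)
    simp only [Function.uncurry]
    ring
  have hswap := integral_integral_swap hprod
  have hleft : ∀ x : Plane, ∫ w : Plane, (A ^ 2 * rexp (-(π * A ^ 2) * ‖w‖ ^ 2) *
      (2 - 2 * Real.cos (2 * π * inner ℝ x w))) * ‖h x‖ ^ 2
      = (2 - 2 * rexp (-(π * ‖x‖ ^ 2 / A ^ 2))) * ‖h x‖ ^ 2 := by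
    intro x
    rw [integral_mul_const, hk]
  have hli : Integrable (fun x => (2 - 2 * rexp (-(π * ‖x‖ ^ 2 / A ^ 2))) * ‖h x‖ ^ 2) volume := by
    have := hprod.integral_prod_left
    refine this.congr (Filter.Eventually.of_forall fun x => ?_)
    exact hleft x
  have hexp : ∀ x : Plane, 0 ≤ 2 - 2 * rexp (-(π * ‖x‖ ^ 2 / A ^ 2)) := by
    intro x
    have : rexp (-(π * ‖x‖ ^ 2 / A ^ 2)) ≤ 1 := by
      rw [Real.exp_le_one_iff]
      have : 0 ≤ π * ‖x‖ ^ 2 / A ^ 2 := by positivity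
      linarith
    linarith
  have hlow : ∫ x, ‖Set.indicator {y : Plane | A ≤ ‖y‖} h x‖ ^ 2 ≤
      ∫ x, (2 - 2 * rexp (-(π * ‖x‖ ^ 2 / A ^ 2))) * ‖h x‖ ^ 2 := by
    refine integral_mono_of_nonneg (Filter.Eventually.of_forall fun x => by positivity) hli
      (Filter.Eventually.of_forall fun x => ?_)
    simp only
    by_cases hx : A ≤ ‖x‖
    · rw [Set.indicator_of_mem (show x ∈ {y : Plane | A ≤ ‖y‖} from hx)]
      refine le_mul_of_one_le_left (by positivity) ?_
      have h1 : 1 ≤ π * ‖x‖ ^ 2 / A ^ 2 := by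
        rw [le_div_iff₀ (by positivity)]
        have : A ^ 2 ≤ ‖x‖ ^ 2 := by gcongr
        nlinarith [Real.pi_gt_three]
      have h2 : rexp (-(π * ‖x‖ ^ 2 / A ^ 2)) ≤ 1 / 2 := by
        rw [Real.exp_neg, inv_le_comm₀ (Real.exp_pos _) (by norm_num)]
        have := Real.add_one_le_exp (π * ‖x‖ ^ 2 / A ^ 2)
        norm_num
        linarith
      linarith
    · rw [Set.indicator_of_notMem (show x ∉ {y : Plane | A ≤ ‖y‖} from hx)]
      have := hexp x
      rw [norm_zero, zero_pow two_ne_zero]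
      exact mul_nonneg this (by positivity)
  have hb2 : 0 < π * A ^ 2 / 2 := by positivity
  have hright : ∀ w : Plane, ∫ x : Plane, (A ^ 2 * rexp (-(π * A ^ 2) * ‖w‖ ^ 2) *
      (2 - 2 * Real.cos (2 * π * inner ℝ x w))) * ‖h x‖ ^ 2
      ≤ (A * M * δ * N) * rexp (-(π * A ^ 2 / 2) * ‖w‖ ^ 2) := by
    intro w
    have e1 : ∫ x : Plane, (A ^ 2 * rexp (-(π * A ^ 2) * ‖w‖ ^ 2) *
        (2 - 2 * Real.cos (2 * π * inner ℝ x w))) * ‖h x‖ ^ 2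
        = (A ^ 2 * rexp (-(π * A ^ 2) * ‖w‖ ^ 2)) *
          ∫ x, (2 - 2 * Real.cos (2 * π * inner ℝ x w)) * ‖h x‖ ^ 2 := by
      rw [← integral_const_mul]
      congr 1; ext x; ring
    rw [e1]
    have h1 := mod_bound hδ hf2 hs hh H w
    have h2 : A * ‖w‖ ≤ rexp ((π * A ^ 2 / 2) * ‖w‖ ^ 2) := by
      have h3 := Real.add_one_le_exp ((π * A ^ 2 / 2) * ‖w‖ ^ 2)
      have h4 : (A * ‖w‖) ^ 2 ≤ (π * A ^ 2 / 2) * ‖w‖ ^ 2 := by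
        have : 0 ≤ (A * ‖w‖) ^ 2 := by positivity
        nlinarith [Real.pi_gt_three]
      nlinarith [sq_nonneg (A * ‖w‖ - 1)]
    calc _ ≤ (A ^ 2 * rexp (-(π * A ^ 2) * ‖w‖ ^ 2)) * (M * δ * ‖w‖ * N) := by gcongr
      _ = (A * M * δ * N) * (rexp (-(π * A ^ 2) * ‖w‖ ^ 2) * (A * ‖w‖)) := by ring
      _ ≤ (A * M * δ * N) * (rexp (-(π * A ^ 2) * ‖w‖ ^ 2) *
            rexp ((π * A ^ 2 / 2) * ‖w‖ ^ 2)) := by gcongr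
      _ = _ := by
        rw [← Real.exp_add]
        congr 2; ring
  refine hlow.trans ?_
  simp only [← hleft]
  rw [hswap]
  calc _ ≤ ∫ w : Plane, (A * M * δ * N) * rexp (-(π * A ^ 2 / 2) * ‖w‖ ^ 2) :=
        integral_mono hprod.integral_prod_right ((gauss_integrable hb2).const_mul _) hright
    _ = _ := by
        rw [integral_const_mul, gauss2' hb2]
        field_simp

/-- If `f ∈ L²(ℝ²)` is supported in `B(0,δ)`, `A ≥ 2δ` and `h = T_{Γ_θ} f` is the half-plane
multiplier operator applied to `f`, then `‖h · 𝟙_{‖x‖ ≥ A}‖₂ ≤ C √(δ/A) ‖f‖₂`. -/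
theorem statement7 :
    ∃ C : ℝ, 0 < C ∧ ∀ (δ A θ : ℝ) (f h : Plane → ℂ), 0 < δ → 2 * δ ≤ A →
      MemLp f 2 (volume : Measure Plane) →
      Function.support f ⊆ Metric.ball (0 : Plane) δ →
      MemLp h 2 (volume : Measure Plane) →
      HasFourierTransform h
        (fun ξ => Set.indicator (halfPlane θ) (fun _ => 1) ξ * 𝓕 f ξ) →
      l2norm2 (Set.indicator {y : Plane | A ≤ ‖y‖} h) ≤
        C * Real.sqrt (δ / A) * l2norm2 f := by
  refine ⟨Real.sqrt (2 * (8 * π + 8 * rexp π)), by positivity, ?_⟩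
  intro δ A θ f h hδ hA hf2 hs hh H
  have hA0 : 0 < A := by linarith
  have key := final_sq hδ hA0 hf2 hs hh H
  unfold l2norm2
  rw [← Real.sqrt_eq_rpow, ← Real.sqrt_eq_rpow, ← Real.sqrt_mul (by positivity),
    ← Real.sqrt_mul (by positivity)]
  exact Real.sqrt_le_sqrt key
end
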